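/- Let f be a C^3 multicritical circle map with irrational rotation number ρ(f) and unique invariant Borel probability measure μ. If ρ(f) is not of bounded type (i.e. ρ(f) ∉ D_0), then μ is singular with respect to the Lebesgue measure on S^1: there exists a Borel set X ⊂ S^1 of zero Lebesgue measure with μ(X) = 1. -/

import Mathlib

open MeasureTheory Set Filter
open scoped ENNReal NNReal

noncomputable section

/-- The circle `S¹ = ℝ/ℤ`. -/
abbrev Circle1 := AddCircle (1 : ℝ)

/-- Projection `ℝ → S¹`. -/
def projC (x : ℝ) : Circle1 := (x : Circle1)

/-- An orientation-preserving circle homeomorphism, given together with a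
(strictly monotone, continuous) lift `F : ℝ → ℝ` satisfying `F (x+1) = F x + 1`. -/
structure CircleHomeo where
  toHomeo : Circle1 ≃ₜ Circle1
  lift : ℝ → ℝ
  lift_strictMono : StrictMono lift
  lift_continuous : Continuous lift
  lift_add_one : ∀ x : ℝ, lift (x + 1) = lift x + 1
  lift_proj : ∀ x : ℝ, toHomeo (projC x) = projC (lift x)

/-- The underlying map `S¹ → S¹`. -/
def CircleHomeo.toFun (H : CircleHomeo) : Circle1 → Circle1 := H.toHomeo

/-- `α ∈ [0,1)` is the rotation number of `H`: `α = lim Fⁿ(x)/n (mod 1)`. -/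
def HasRotationNumber (H : CircleHomeo) (α : ℝ) : Prop :=
  α ∈ Set.Ico (0 : ℝ) 1 ∧ ∃ β : ℝ, Int.fract β = α ∧
    ∀ x : ℝ, Filter.Tendsto (fun n : ℕ => H.lift^[n] x / n) Filter.atTop (nhds β)

/-- `μ` is an invariant Borel probability measure for `H`. -/
def IsInvProbMeasure (H : CircleHomeo) (μ : Measure Circle1) : Prop :=
  IsProbabilityMeasure μ ∧ μ.map H.toFun = μ

/-- Hausdorff dimension of a measure: `inf {dim_H X : μ X = 1}`. -/
def dimHMeasure (μ : Measure Circle1) : ℝ≥0∞ :=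
  ⨅ (X : Set Circle1) (_ : MeasurableSet X) (_ : μ X = 1), dimH X

/-- The set `D(γ,τ)` of Diophantine numbers of type `(γ,τ)`. -/
def DiophClass (γ τ : ℝ) : Set ℝ :=
  {α : ℝ | ∀ p q : ℤ, q ≠ 0 → γ / |(q : ℝ)| ^ (τ + 2) ≤ |α - (p : ℝ) / (q : ℝ)|}

/-- The set `D_τ = ⋃_{γ > 0} D(γ,τ)`. -/
def DiophTau (τ : ℝ) : Set ℝ := {α : ℝ | ∃ γ > 0, α ∈ DiophClass γ τ}

/-- Iterates of the Gauss map, starting from `α`. -/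
def gaussIter (α : ℝ) : ℕ → ℝ
  | 0 => α
  | n + 1 => Int.fract (1 / gaussIter α n)

/-- The `n`-th partial quotient `a_n` (`n ≥ 1`) of the continued fraction of `α`. -/
def cfA (α : ℝ) (n : ℕ) : ℕ := ⌊1 / gaussIter α (n - 1)⌋₊

/-- Denominators of the convergents: `q_0 = 1`, `q_1 = a_1`, `q_n = a_n q_{n-1} + q_{n-2}`. -/
def cfQ (α : ℝ) : ℕ → ℕ
  | 0 => 1
  | 1 => cfA α 1
  | n + 2 => cfA α (n + 2) * cfQ α (n + 1) + cfQ α n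

/-- Positive displacement from `a` to `z` on the circle, a number in `[0,1)`. -/
def circDisp (a z : Circle1) : ℝ := (AddCircle.equivIco 1 0 (z - a)).1

/-- The circle arc `[a, b)`. -/
def arcIco (a b : Circle1) : Set Circle1 := {z : Circle1 | circDisp a z < circDisp a b}

namespace DynPart

/-- `x_i = f^i(x_0)`. -/
def pt (H : CircleHomeo) (x0 : Circle1) (i : ℕ) : Circle1 := H.toFun^[i] x0

/-- The interval `I_n`: `[x_0, x_{q_n})` for even `n`, `[x_{q_n}, x_0)` for odd `n`. -/
def In (H : CircleHomeo) (α : ℝ) (x0 : Circle1) (n : ℕ) : Set Circle1 :=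
  if Even n then arcIco x0 (pt H x0 (cfQ α n)) else arcIco (pt H x0 (cfQ α n)) x0

/-- `I_n^i = f^i(I_n)`. -/
def Ini (H : CircleHomeo) (α : ℝ) (x0 : Circle1) (n i : ℕ) : Set Circle1 :=
  H.toFun^[i] '' In H α x0 n

/-- The dynamical partition `P_n(x_0)`. -/
def part (H : CircleHomeo) (α : ℝ) (x0 : Circle1) (n : ℕ) : Set (Set Circle1) :=
  {S | ∃ i < cfQ α n, S = Ini H α x0 (n - 1) i} ∪
  {S | ∃ i < cfQ α (n - 1), S = Ini H α x0 n i}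

/-- `Δ^{(n)}_{i,j} = I_n^{i + q_{n-1} + j q_n}`. -/
def Δ (H : CircleHomeo) (α : ℝ) (x0 : Circle1) (n i j : ℕ) : Set Circle1 :=
  Ini H α x0 n (i + cfQ α (n - 1) + j * cfQ α n)

end DynPart

/-- `φ` is a `C³` diffeomorphism from the open set `U` onto the open set `V`. -/
def IsC3DiffeoOn (φ : ℝ → ℝ) (U V : Set ℝ) : Prop :=
  IsOpen U ∧ IsOpen V ∧ ContDiffOn ℝ 3 φ U ∧ Set.BijOn φ U V ∧ ∀ x ∈ U, deriv φ x ≠ 0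

/-- `c` is a critical point of power-law type with exponent `p`: in suitable `C³`
coordinates around `c` and `H c`, the map takes the form `x ↦ x |x|^{p-1}`. -/
def IsPowerLawCritPt (H : CircleHomeo) (c p : ℝ) : Prop :=
  ∃ (U V U' V' : Set ℝ) (φ ψ : ℝ → ℝ),
    c ∈ U ∧ H.lift c ∈ U' ∧ (0 : ℝ) ∈ V ∧ (0 : ℝ) ∈ V' ∧
    IsC3DiffeoOn φ U V ∧ IsC3DiffeoOn ψ U' V' ∧
    φ c = 0 ∧ ψ (H.lift c) = 0 ∧ Set.MapsTo H.lift U U' ∧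
    ∀ x ∈ U, ψ (H.lift x) = φ x * |φ x| ^ (p - 1)

/-- A `C³` multicritical circle map: an orientation-preserving `C³` circle
homeomorphism whose critical points are exactly `c_0, …, c_{N-1}` (represented in
`[0,1)`), each of power-law type with criticality `p_i > 1`. -/
structure MulticriticalCircleMap extends CircleHomeo where
  smooth : ContDiff ℝ 3 lift
  N : ℕ
  N_pos : 0 < N
  crit : Fin N → ℝ
  crit_mem : ∀ i, crit i ∈ Set.Ico (0 : ℝ) 1
  crit_inj : Function.Injective crit
  critExp : Fin N → ℝ
  critExp_gt_one : ∀ i, 1 < critExp i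
  crit_powerLaw : ∀ i, IsPowerLawCritPt toCircleHomeo (crit i) (critExp i)
  crit_complete : ∀ x : ℝ, deriv lift x = 0 → ∃ (i : Fin N) (k : ℤ), x = crit i + (k : ℝ)

/-- `z ∈ S¹` is a critical point of `f^m`. -/
def IsCritPtOfIter (f : MulticriticalCircleMap) (m : ℕ) (z : Circle1) : Prop :=
  ∃ x : ℝ, projC x = z ∧ deriv (f.lift^[m]) x = 0

/-- Indices `0 < j < a_{n+1} - 1` such that the closure of `Δ_j^{(n)}` contains a
critical point of `T_n = f^{q_n}`. -/
def critTimesSet (f : MulticriticalCircleMap) (α : ℝ) (x0 : Circle1) (n : ℕ) : Finset ℕ :=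
  @Finset.filter ℕ
    (fun j => ∃ z ∈ closure (DynPart.Δ f.toCircleHomeo α x0 n 0 j),
      IsCritPtOfIter f (cfQ α n) z)
    (Classical.decPred _)
    (Finset.Ioo 0 (cfA α (n + 1) - 1))

/-- The number `r_n` of bridges (`r_n = #{interior critical times} + 1`). -/
def rn (f : MulticriticalCircleMap) (α : ℝ) (x0 : Circle1) (n : ℕ) : ℕ :=
  (critTimesSet f α x0 n).card + 1

/-- The critical times `0 = k_0^{(n)} < k_1^{(n)} < … < k_{r_n}^{(n)} = a_{n+1} - 1`. -/
def kTime (f : MulticriticalCircleMap) (α : ℝ) (x0 : Circle1) (n : ℕ) (s : ℕ) : ℕ :=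
  (((0 : ℕ) :: (critTimesSet f α x0 n).sort (· ≤ ·)) ++ [cfA α (n + 1) - 1]).getD s
    (cfA α (n + 1) - 1)

/-- The `s`-th bridge `G_s^{(n)} = ⋃_{k_s < j < k_{s+1}} Δ_j^{(n)}`. -/
def bridge (f : MulticriticalCircleMap) (α : ℝ) (x0 : Circle1) (n s : ℕ) : Set Circle1 :=
  ⋃ j ∈ Set.Ioo (kTime f α x0 n s) (kTime f α x0 n (s + 1)),
    DynPart.Δ f.toCircleHomeo α x0 n 0 j

/-- The trimmed bridge `G_{s,γ}^{(n)}`. -/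
def bridgeGamma (f : MulticriticalCircleMap) (α : ℝ) (x0 : Circle1) (n : ℕ) (γ : ℝ)
    (s : ℕ) : Set Circle1 :=
  ⋃ j ∈ {j : ℕ | (kTime f α x0 n s : ℝ) + (cfA α (n + 1) : ℝ) ^ γ < (j : ℝ) ∧
      (j : ℝ) < (kTime f α x0 n (s + 1) : ℝ) + 1 - (cfA α (n + 1) : ℝ) ^ γ},
    DynPart.Δ f.toCircleHomeo α x0 n 0 j

/-- `A^n_{i,γ} = ⋃_{s < r_n} f^i(G_{s,γ}^{(n)})`. -/
def Aset (f : MulticriticalCircleMap) (α : ℝ) (x0 : Circle1) (n i : ℕ) (γ : ℝ) :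
    Set Circle1 :=
  ⋃ s ∈ Set.Iio (rn f α x0 n), f.toCircleHomeo.toFun^[i] '' bridgeGamma f α x0 n γ s

/-- `A^n_γ = ⋃_{i < q_n} A^n_{i,γ}`. -/
def AsetAll (f : MulticriticalCircleMap) (α : ℝ) (x0 : Circle1) (n : ℕ) (γ : ℝ) :
    Set Circle1 :=
  ⋃ i ∈ Set.Iio (cfQ α n), Aset f α x0 n i γ

/-- The Schwarzian derivative `Sf = f'''/f' - (3/2)(f''/f')²`. -/
def schwarzianAt (f : ℝ → ℝ) (x : ℝ) : ℝ :=
  iteratedDeriv 3 f x / deriv f x - 3 / 2 * (iteratedDeriv 2 f x / deriv f x) ^ 2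

end

/-- The cross-ratio `(c - a) (d - b) / ((b - a) (d - c))` of four real numbers. -/
noncomputable def crossRatio (a b c d : ℝ) : ℝ :=
  ((c - a) * (d - b)) / ((b - a) * (d - c))

/-- The odd power map `x ↦ x |x|^{p-1}`. -/
noncomputable def oddPow (p x : ℝ) : ℝ := x * |x| ^ (p - 1)

lemma crossRatio_pos {a b c d : ℝ} (h1 : a < b) (h2 : b < c) (h3 : c < d) :
    0 < crossRatio a b c d := by
  unfold crossRatio
  have := sub_pos.2 h1; have := sub_pos.2 h3
  have := sub_pos.2 (h1.trans h2); have := sub_pos.2 (h2.trans h3)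
  positivity

lemma crossRatio_reverse (a b c d : ℝ) :
    crossRatio (-d) (-c) (-b) (-a) = crossRatio a b c d := by
  unfold crossRatio
  congr 1 <;> ring

lemma crossRatio_add (a b c d t : ℝ) :
    crossRatio (a + t) (b + t) (c + t) (d + t) = crossRatio a b c d := by
  unfold crossRatio
  congr 1 <;> ring

lemma oddPow_neg (p x : ℝ) : oddPow p (-x) = -oddPow p x := by
  simp [oddPow]

lemma oddPow_of_nonneg {p x : ℝ} (hp : 1 < p) (hx : 0 ≤ x) : oddPow p x = x ^ p := by
  rcases hx.eq_or_lt with rfl | hx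
  · simp [oddPow, Real.zero_rpow (by linarith : p ≠ 0)]
  · rw [oddPow, abs_of_pos hx, Real.rpow_sub_one hx.ne']
    field_simp

lemma oddPow_zero (p : ℝ) : oddPow p 0 = 0 := by simp [oddPow]

lemma oddPow_strictMono {p : ℝ} (hp : 1 < p) : StrictMono (oddPow p) := by
  have key : ∀ x y : ℝ, 0 ≤ x → x < y → oddPow p x < oddPow p y := by
    intro x y hx hxy
    rw [oddPow_of_nonneg hp hx, oddPow_of_nonneg hp (hx.trans hxy.le)]
    exact Real.rpow_lt_rpow hx hxy (by linarith)
  intro x y hxy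
  rcases le_or_gt 0 x with hx | hx
  · exact key x y hx hxy
  rcases le_or_gt y 0 with hy | hy
  · have := key (-y) (-x) (by linarith) (by linarith)
    rw [oddPow_neg, oddPow_neg] at this
    linarith
  · have h1 := key 0 y le_rfl hy
    have h2 := key 0 (-x) le_rfl (by linarith)
    rw [oddPow_neg] at h2
    rw [oddPow_zero] at h1 h2
    linarith

lemma sinh_mul_sinh_le {p s t : ℝ} (hp : 1 ≤ p) (hs : 0 ≤ s) (hst : s ≤ t) :
    Real.sinh (p * s) * Real.sinh t ≤ Real.sinh (p * t) * Real.sinh s := by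
  rcases hs.eq_or_lt with rfl | hs
  · simp
  have hN : ∀ x : ℝ, 0 ≤ x →
      0 ≤ p * Real.cosh (p * x) * Real.sinh x - Real.sinh (p * x) * Real.cosh x := by
    have hmono : MonotoneOn
        (fun x => p * Real.cosh (p * x) * Real.sinh x - Real.sinh (p * x) * Real.cosh x)
        (Ici 0) := by
      have hd : ∀ x : ℝ, HasDerivAt
          (fun x => p * Real.cosh (p * x) * Real.sinh x - Real.sinh (p * x) * Real.cosh x)
          ((p ^ 2 - 1) * (Real.sinh (p * x) * Real.sinh x)) x := by
        intro x
        have hpx : HasDerivAt (fun x : ℝ => p * x) p x := by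
          simpa using (hasDerivAt_id x).const_mul p
        have h1 := ((hpx.cosh.const_mul p).mul (Real.hasDerivAt_sinh x)).sub
          (hpx.sinh.mul (Real.hasDerivAt_cosh x))
        refine h1.congr_deriv ?_
        ring
      refine monotoneOn_of_deriv_nonneg (convex_Ici 0) ?_ ?_ ?_
      · exact fun x _ => (hd x).continuousAt.continuousWithinAt
      · exact fun x _ => (hd x).differentiableAt.differentiableWithinAt
      · intro x hx
        rw [interior_Ici] at hx
        have hx' : 0 < x := hx
        rw [(hd x).deriv]
        have h1 : 0 ≤ Real.sinh x := Real.sinh_nonneg_iff.2 hx'.le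
        have h2 : 0 ≤ Real.sinh (p * x) := Real.sinh_nonneg_iff.2 (by positivity)
        have : 0 ≤ p ^ 2 - 1 := by nlinarith
        positivity
    intro x hx
    have := hmono (mem_Ici.2 le_rfl) (mem_Ici.2 hx) hx
    simpa using this
  have hmono : MonotoneOn (fun x => Real.sinh (p * x) / Real.sinh x) (Ioi 0) := by
    have hd : ∀ x : ℝ, 0 < x → HasDerivAt (fun x => Real.sinh (p * x) / Real.sinh x)
        ((p * Real.cosh (p * x) * Real.sinh x - Real.sinh (p * x) * Real.cosh x)
          / Real.sinh x ^ 2) x := by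
      intro x hx
      have hpx : HasDerivAt (fun x : ℝ => p * x) p x := by
        simpa using (hasDerivAt_id x).const_mul p
      have h1 := hpx.sinh.div (Real.hasDerivAt_sinh x) (Real.sinh_pos_iff.2 hx).ne'
      refine h1.congr_deriv ?_
      ring
    refine monotoneOn_of_deriv_nonneg (convex_Ioi 0) ?_ ?_ ?_
    · exact fun x hx => (hd x hx).continuousAt.continuousWithinAt
    · rw [interior_Ioi]
      exact fun x hx => (hd x hx).differentiableAt.differentiableWithinAt
    · rw [interior_Ioi]
      intro x hx
      rw [(hd x hx).deriv]
      have := hN x (le_of_lt hx)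
      positivity
  have h := hmono (mem_Ioi.2 hs) (mem_Ioi.2 (hs.trans_le hst)) hst
  simp only at h
  rwa [div_le_div_iff₀ (Real.sinh_pos_iff.2 hs) (Real.sinh_pos_iff.2 (hs.trans_le hst))] at h

lemma exp_sub_exp_eq_sinh (A B p : ℝ) :
    Real.exp (2 * A) ^ p = Real.exp (2 * p * A) ∧
    Real.exp (2 * p * B) - Real.exp (2 * p * A) =
      2 * Real.exp (p * (A + B)) * Real.sinh (p * (B - A)) := by
  constructor
  · rw [← Real.exp_mul]; ring_nf
  · rw [Real.sinh_eq]
    have h1 : Real.exp (2 * p * B) = Real.exp (p * (A + B)) * Real.exp (p * (B - A)) := by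
      rw [← Real.exp_add]; ring_nf
    have h2 : Real.exp (2 * p * A) = Real.exp (p * (A + B)) * Real.exp (-(p * (B - A))) := by
      rw [← Real.exp_add]; ring_nf
    rw [h1, h2]; ring

/-- Growth of the slopes of `x ↦ x^p` when the right end point moves. -/
lemma rpow_slope_right {p a b c : ℝ} (hp : 1 < p) (ha : 0 < a) (hab : a < b) (hbc : b < c) :
    (c / b) ^ ((p - 1) / 2) * ((b ^ p - a ^ p) * (c - a)) ≤ (c ^ p - a ^ p) * (b - a) := by
  obtain ⟨A, rfl⟩ : ∃ A, a = Real.exp (2 * A) := ⟨Real.log a / 2, by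
    rw [mul_div_cancel₀ _ two_ne_zero, Real.exp_log ha]⟩
  obtain ⟨B, rfl⟩ : ∃ B, b = Real.exp (2 * B) := ⟨Real.log b / 2, by
    rw [mul_div_cancel₀ _ two_ne_zero, Real.exp_log (ha.trans hab)]⟩
  obtain ⟨C, rfl⟩ : ∃ C, c = Real.exp (2 * C) := ⟨Real.log c / 2, by
    rw [mul_div_cancel₀ _ two_ne_zero, Real.exp_log (ha.trans (hab.trans hbc))]⟩
  rw [Real.exp_lt_exp] at hab hbc
  have hs := sinh_mul_sinh_le hp.le (by linarith : 0 ≤ B - A) (by linarith : B - A ≤ C - A)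
  rw [(exp_sub_exp_eq_sinh A B p).1, (exp_sub_exp_eq_sinh B B p).1, (exp_sub_exp_eq_sinh C B p).1,
    (exp_sub_exp_eq_sinh A B p).2, (exp_sub_exp_eq_sinh A C p).2]
  have e1 := (exp_sub_exp_eq_sinh A B 1).2
  have e2 := (exp_sub_exp_eq_sinh A C 1).2
  simp only [mul_one, one_mul] at e1 e2
  rw [e1, e2, ← Real.exp_sub, ← Real.exp_mul]
  have hE : Real.exp ((2 * C - 2 * B) * ((p - 1) / 2)) * (Real.exp (p * (A + B)) *
      Real.exp (A + C)) = Real.exp (p * (A + C)) * Real.exp (A + B) := by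
    rw [← Real.exp_add, ← Real.exp_add, ← Real.exp_add]; ring_nf
  have hpos : 0 < Real.exp (p * (A + C)) * Real.exp (A + B) := by positivity
  calc _ = 4 * (Real.exp ((2 * C - 2 * B) * ((p - 1) / 2)) * (Real.exp (p * (A + B)) *
      Real.exp (A + C))) * (Real.sinh (p * (B - A)) * Real.sinh (C - A)) := by ring
    _ = 4 * (Real.exp (p * (A + C)) * Real.exp (A + B)) *
      (Real.sinh (p * (B - A)) * Real.sinh (C - A)) := by rw [hE]
    _ ≤ 4 * (Real.exp (p * (A + C)) * Real.exp (A + B)) *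
      (Real.sinh (p * (C - A)) * Real.sinh (B - A)) := by gcongr
    _ = _ := by ring

/-- Growth of the slopes of `x ↦ x^p` when the left end point moves. -/
lemma rpow_slope_left {p b c d : ℝ} (hp : 1 < p) (hb : 0 < b) (hbc : b < c) (hcd : c < d) :
    (b / c) ^ ((p - 1) / 2) * ((d ^ p - c ^ p) * (d - b)) ≤ (d ^ p - b ^ p) * (d - c) := by
  obtain ⟨B, rfl⟩ : ∃ B, b = Real.exp (2 * B) := ⟨Real.log b / 2, by
    rw [mul_div_cancel₀ _ two_ne_zero, Real.exp_log hb]⟩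
  obtain ⟨C, rfl⟩ : ∃ C, c = Real.exp (2 * C) := ⟨Real.log c / 2, by
    rw [mul_div_cancel₀ _ two_ne_zero, Real.exp_log (hb.trans hbc)]⟩
  obtain ⟨D, rfl⟩ : ∃ D, d = Real.exp (2 * D) := ⟨Real.log d / 2, by
    rw [mul_div_cancel₀ _ two_ne_zero, Real.exp_log (hb.trans (hbc.trans hcd))]⟩
  rw [Real.exp_lt_exp] at hbc hcd
  have hs := sinh_mul_sinh_le hp.le (by linarith : 0 ≤ D - C) (by linarith : D - C ≤ D - B)
  rw [(exp_sub_exp_eq_sinh B B p).1, (exp_sub_exp_eq_sinh C B p).1, (exp_sub_exp_eq_sinh D B p).1,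
    (exp_sub_exp_eq_sinh C D p).2, (exp_sub_exp_eq_sinh B D p).2]
  have e1 := (exp_sub_exp_eq_sinh B D 1).2
  have e2 := (exp_sub_exp_eq_sinh C D 1).2
  simp only [mul_one, one_mul] at e1 e2
  rw [e1, e2, ← Real.exp_sub, ← Real.exp_mul]
  have hE : Real.exp ((2 * B - 2 * C) * ((p - 1) / 2)) * (Real.exp (p * (C + D)) *
      Real.exp (B + D)) = Real.exp (p * (B + D)) * Real.exp (C + D) := by
    rw [← Real.exp_add, ← Real.exp_add, ← Real.exp_add]; ring_nf
  calc _ = 4 * (Real.exp ((2 * B - 2 * C) * ((p - 1) / 2)) * (Real.exp (p * (C + D)) *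
      Real.exp (B + D))) * (Real.sinh (p * (D - C)) * Real.sinh (D - B)) := by ring
    _ = 4 * (Real.exp (p * (B + D)) * Real.exp (C + D)) *
      (Real.sinh (p * (D - C)) * Real.sinh (D - B)) := by rw [hE]
    _ ≤ 4 * (Real.exp (p * (B + D)) * Real.exp (C + D)) *
      (Real.sinh (p * (D - B)) * Real.sinh (D - C)) := by gcongr
    _ = _ := by ring

/-- Product form of a lower bound for the distortion of the cross-ratio. -/
lemma crossRatio_mul_le {a b c d a' b' c' d' s t : ℝ} (h1 : a < b) (h2 : b < c) (h3 : c < d)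
    (h1' : a' < b') (h2' : b' < c') (h3' : c' < d') (ht : 0 ≤ t)
    (hs : s * ((b' - a') * (c - a)) ≤ (c' - a') * (b - a))
    (hts : t * ((d' - c') * (d - b)) ≤ (d' - b') * (d - c)) :
    s * t * crossRatio a b c d ≤ crossRatio a' b' c' d' := by
  have e1 := sub_pos.2 h1; have e2 := sub_pos.2 h3
  have e3 := sub_pos.2 h1'; have e4 := sub_pos.2 h3'
  have e5 := sub_pos.2 (h1'.trans h2'); have e6 := sub_pos.2 (h2.trans h3)
  unfold crossRatio
  rw [mul_div_assoc', div_le_div_iff₀ (by positivity) (by positivity)]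
  have hA : 0 ≤ t * ((d' - c') * (d - b)) := by positivity
  have hB : 0 ≤ (c' - a') * (b - a) := by positivity
  have := mul_le_mul hs hts hA hB
  nlinarith [this]

lemma crossRatio_oddPow_of_pos {p a b c d : ℝ} (hp : 1 < p) (ha : 0 < a) (h1 : a < b) (h2 : b < c)
    (h3 : c < d) :
    crossRatio a b c d ≤ crossRatio (oddPow p a) (oddPow p b) (oddPow p c) (oddPow p d) := by
  have hm := oddPow_strictMono hp
  have hb := ha.trans h1
  have hc := hb.trans h2
  have hd := hc.trans h3
  have := crossRatio_mul_le (s := (c / b) ^ ((p - 1) / 2)) (t := (b / c) ^ ((p - 1) / 2))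
    h1 h2 h3 (hm h1) (hm h2) (hm h3) (by positivity)
    (by
      rw [oddPow_of_nonneg hp ha.le, oddPow_of_nonneg hp hb.le, oddPow_of_nonneg hp hc.le]
      exact rpow_slope_right hp ha h1 h2)
    (by
      rw [oddPow_of_nonneg hp hd.le, oddPow_of_nonneg hp hb.le, oddPow_of_nonneg hp hc.le]
      exact rpow_slope_left hp hb h2 h3)
  rwa [← Real.mul_rpow (by positivity) (by positivity),
    show c / b * (b / c) = 1 by field_simp, Real.one_rpow, one_mul] at this

lemma crossRatio_oddPow_zero {p b c d : ℝ} (hp : 1 < p) (hb : 0 < b) (h2 : b < c) (h3 : c < d) :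
    (c / b) ^ ((p - 1) / 2) * crossRatio 0 b c d ≤
      crossRatio (oddPow p 0) (oddPow p b) (oddPow p c) (oddPow p d) := by
  have hm := oddPow_strictMono hp
  have hc := hb.trans h2
  have hd := hc.trans h3
  have := crossRatio_mul_le (s := (c / b) ^ (p - 1)) (t := (b / c) ^ ((p - 1) / 2))
    hb h2 h3 (hm hb) (hm h2) (hm h3) (by positivity)
    (by
      rw [oddPow_zero, oddPow_of_nonneg hp hb.le, oddPow_of_nonneg hp hc.le,
        Real.div_rpow hc.le hb.le, Real.rpow_sub_one hb.ne', Real.rpow_sub_one hc.ne']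
      have := (Real.rpow_pos_of_pos hb p).ne'
      refine le_of_eq ?_
      field_simp
      ring)
    (by
      rw [oddPow_of_nonneg hp hd.le, oddPow_of_nonneg hp hb.le, oddPow_of_nonneg hp hc.le]
      exact rpow_slope_left hp hb h2 h3)
  have e : (c / b) ^ (p - 1) * (b / c) ^ ((p - 1) / 2) = (c / b) ^ ((p - 1) / 2) := by
    have h : (b / c) = (c / b)⁻¹ := by rw [inv_div]
    rw [h, Real.inv_rpow (by positivity), ← Real.rpow_neg (by positivity),
      ← Real.rpow_add (by positivity)]
    ring_nf
  rwa [e] at this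

/-- Away from its critical point the odd power map does not decrease cross-ratios. -/
lemma crossRatio_oddPow {p a b c d : ℝ} (hp : 1 < p) (h1 : a < b) (h2 : b < c) (h3 : c < d)
    (h0 : ¬ (a < 0 ∧ 0 < d)) :
    crossRatio a b c d ≤ crossRatio (oddPow p a) (oddPow p b) (oddPow p c) (oddPow p d) := by
  have key : ∀ a b c d : ℝ, 0 ≤ a → a < b → b < c → c < d →
      crossRatio a b c d ≤ crossRatio (oddPow p a) (oddPow p b) (oddPow p c) (oddPow p d) := by
    intro a b c d ha h1 h2 h3
    rcases ha.eq_or_lt with rfl | ha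
    · refine le_trans ?_ (crossRatio_oddPow_zero hp h1 h2 h3)
      have : 1 ≤ (c / b) ^ ((p - 1) / 2) :=
        Real.one_le_rpow (by rw [one_le_div h1]; exact h2.le) (by linarith)
      have hpos := crossRatio_pos h1 h2 h3
      nlinarith
    · exact crossRatio_oddPow_of_pos hp ha h1 h2 h3
  rcases le_or_gt 0 a with ha | ha
  · exact key a b c d ha h1 h2 h3
  · have hd : d ≤ 0 := by
      by_contra h
      exact h0 ⟨ha, not_le.1 h⟩
    have := key (-d) (-c) (-b) (-a) (by linarith) (by linarith) (by linarith) (by linarith)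
    rwa [oddPow_neg, oddPow_neg, oddPow_neg, oddPow_neg, crossRatio_reverse,
      crossRatio_reverse] at this

lemma rpow_sub_rpow_le {p b c : ℝ} (hp : 1 < p) (hb : 0 ≤ b) (hbc : b ≤ c) :
    c ^ p - b ^ p ≤ p * c ^ (p - 1) * (c - b) := by
  rcases (hb.trans hbc).eq_or_lt with h | hc
  · have : b = c := le_antisymm hbc (by linarith)
    simp [this]
  have h := one_add_mul_self_le_rpow_one_add (s := b / c - 1)
    (by have : 0 ≤ b / c := by positivity
        linarith) hp.le
  rw [add_sub_cancel, Real.div_rpow hb hc.le, le_div_iff₀ (by positivity)] at h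
  rw [Real.rpow_sub_one hc.ne']
  have : (1 + p * (b / c - 1)) * c ^ p = c ^ p - p * (c ^ p / c) * (c - b) := by
    field_simp
    ring
  linarith

lemma le_rpow_sub_rpow {p b c : ℝ} (hp : 1 < p) (hb : 0 ≤ b) (hbc : b ≤ c) :
    c ^ (p - 1) * (c - b) ≤ c ^ p - b ^ p := by
  rcases hb.eq_or_lt with rfl | hb
  · rcases hbc.eq_or_lt with rfl | hc
    · simp
    · rw [Real.zero_rpow (by linarith), Real.rpow_sub_one hc.ne']
      refine le_of_eq ?_
      field_simp
      ring
  · have h := Real.rpow_le_rpow hb.le hbc (by linarith : 0 ≤ p - 1)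
    rw [Real.rpow_sub_one hb.ne'] at h
    have hc := hb.trans_le hbc
    have e : c ^ p = c ^ (p - 1) * c := by
      rw [Real.rpow_sub_one hc.ne']; field_simp
    have := mul_le_mul_of_nonneg_right h hb.le
    rw [div_mul_cancel₀ _ hb.ne'] at this
    rw [e]; linarith

/-- Upper bound for the slopes of the odd power map on `[-M, M]`. -/
lemma oddPow_sub_le {p b c M : ℝ} (hp : 1 < p) (hbc : b ≤ c) (hb : -M ≤ b) (hc : c ≤ M) :
    oddPow p c - oddPow p b ≤ p * M ^ (p - 1) * (c - b) := by
  have key : ∀ b c : ℝ, 0 ≤ b → b ≤ c → c ≤ M →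
      oddPow p c - oddPow p b ≤ p * M ^ (p - 1) * (c - b) := by
    intro b c hb hbc hc
    rw [oddPow_of_nonneg hp hb, oddPow_of_nonneg hp (hb.trans hbc)]
    refine (rpow_sub_rpow_le hp hb hbc).trans ?_
    have := Real.rpow_le_rpow (hb.trans hbc) hc (by linarith : 0 ≤ p - 1)
    have : 0 ≤ c - b := by linarith
    gcongr
  have key' : ∀ b c : ℝ, c ≤ 0 → b ≤ c → -M ≤ b →
      oddPow p c - oddPow p b ≤ p * M ^ (p - 1) * (c - b) := by
    intro b c hc hbc hb
    have := key (-c) (-b) (by linarith) (by linarith) (by linarith)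
    rw [oddPow_neg, oddPow_neg] at this
    linarith
  rcases le_or_gt 0 b with h | h
  · exact key b c h hbc hc
  rcases le_or_gt c 0 with h' | h'
  · exact key' b c h' hbc hb
  · have e1 := key 0 c le_rfl h'.le hc
    have e2 := key' b 0 le_rfl h.le hb
    linarith

/-- Lower bound for the slopes of the odd power map. -/
lemma le_oddPow_sub {p a d : ℝ} (hp : 1 < p) (had : a ≤ d) :
    max |a| |d| ^ (p - 1) / 2 * (d - a) ≤ oddPow p d - oddPow p a := by
  have key : ∀ a d : ℝ, 0 ≤ a → a ≤ d → d ^ (p - 1) * (d - a) ≤ oddPow p d - oddPow p a := by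
    intro a d ha had
    rw [oddPow_of_nonneg hp ha, oddPow_of_nonneg hp (ha.trans had)]
    exact le_rpow_sub_rpow hp ha had
  have key' : ∀ a d : ℝ, d ≤ 0 → a ≤ d → (-a) ^ (p - 1) * (d - a) ≤ oddPow p d - oddPow p a := by
    intro a d hd had
    have := key (-d) (-a) (by linarith) (by linarith)
    rw [oddPow_neg, oddPow_neg] at this
    linarith
  rcases le_or_gt 0 a with h | h
  · have := key a d h had
    have hM : max |a| |d| = d := by
      rw [abs_of_nonneg h, abs_of_nonneg (h.trans had), max_eq_right had]
    rw [hM]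
    have h0 : 0 ≤ d ^ (p - 1) * (d - a) :=
      mul_nonneg (Real.rpow_nonneg (h.trans had) _) (by linarith)
    linarith
  rcases le_or_gt d 0 with h' | h'
  · have := key' a d h' had
    have hM : max |a| |d| = -a := by
      rw [abs_of_neg h, abs_of_nonpos h', max_eq_left (by linarith)]
    rw [hM]
    have h0 : 0 ≤ (-a) ^ (p - 1) * (d - a) :=
      mul_nonneg (Real.rpow_nonneg (by linarith) _) (by linarith)
    linarith
  · have e1 := key 0 d le_rfl h'.le
    have e2 := key' a 0 le_rfl h.le
    rw [oddPow_zero] at e1 e2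
    have p1 : 0 ≤ d ^ (p - 1) := Real.rpow_nonneg h'.le _
    have p2 : 0 ≤ (-a) ^ (p - 1) := Real.rpow_nonneg (by linarith) _
    rw [abs_of_neg h, abs_of_pos h']
    rcases le_total (-a) d with h3 | h3
    · rw [max_eq_right h3]; nlinarith
    · rw [max_eq_left h3]; nlinarith

/-- The slope of the odd power map over a subinterval is controlled by the total slope. -/
lemma oddPow_slope {p a b c d : ℝ} (hp : 1 < p) (hab : a ≤ b) (hbc : b ≤ c) (hcd : c ≤ d) :
    (oddPow p c - oddPow p b) * (d - a) ≤ 2 * p * ((oddPow p d - oddPow p a) * (c - b)) := by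
  set M := max |a| |d| with hM
  have h1 : oddPow p c - oddPow p b ≤ p * M ^ (p - 1) * (c - b) := by
    apply oddPow_sub_le hp hbc
    · have := neg_abs_le a
      have := le_max_left |a| |d|
      linarith
    · have := le_abs_self d
      have := le_max_right |a| |d|
      linarith
  have h2 := le_oddPow_sub hp (hab.trans (hbc.trans hcd))
  rw [← hM] at h2
  have e1 : 0 ≤ d - a := by linarith
  have e2 : 0 ≤ p * (c - b) := mul_nonneg (by linarith) (by linarith)
  have h3 := mul_le_mul_of_nonneg_right h1 e1
  have h4 := mul_le_mul_of_nonneg_left h2 e2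
  nlinarith

lemma exp_neg_two_mul_le {t : ℝ} (ht : 0 ≤ t) (ht' : t ≤ 1 / 2) :
    Real.exp (-(2 * t)) ≤ 1 - t := by
  rw [Real.exp_neg, inv_le_comm₀ (Real.exp_pos _) (by linarith)]
  refine le_trans ?_ (Real.add_one_le_exp (2 * t))
  rw [inv_le_iff_one_le_mul₀ (by linarith)]
  nlinarith

/-- Near a point, a `C³` function has a first order Taylor expansion of its derivative. -/
lemma exists_taylor_deriv {φ : ℝ → ℝ} {U : Set ℝ} {x₀ : ℝ} (hU : IsOpen U) (hx : x₀ ∈ U)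
    (hφ : ContDiffOn ℝ 3 φ U) :
    ∃ B K : ℝ, 0 ≤ B ∧ 0 ≤ K ∧ ∃ ε > 0, ∀ x ∈ Ioo (x₀ - ε) (x₀ + ε),
      DifferentiableAt ℝ φ x ∧ |deriv (deriv φ) x| ≤ B ∧ ∀ y ∈ Ioo (x₀ - ε) (x₀ + ε),
        |deriv φ y - deriv φ x - deriv (deriv φ) x * (y - x)| ≤ K * (y - x) ^ 2 := by
  have h2 : ContDiffOn ℝ 2 (deriv φ) U :=
    ((contDiffOn_succ_iff_deriv_of_isOpen (n := 2) hU).1 (by exact_mod_cast hφ)).2.2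
  have h1 : ContDiffOn ℝ 1 (deriv (deriv φ)) U :=
    ((contDiffOn_succ_iff_deriv_of_isOpen (n := 1) hU).1 (by exact_mod_cast h2)).2.2
  have hUx := hU.mem_nhds hx
  obtain ⟨K, t, ht, hK⟩ := (h1.contDiffAt hUx).exists_lipschitzOnWith
  have hB : ∀ᶠ x in nhds x₀, |deriv (deriv φ) x| < |deriv (deriv φ) x₀| + 1 :=
    (h1.contDiffAt hUx).continuousAt.abs.eventually_lt continuousAt_const (by simp)
  obtain ⟨ε, hε, hball⟩ := Metric.mem_nhds_iff.1 (inter_mem (inter_mem hUx ht) hB)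
  rw [Real.ball_eq_Ioo] at hball
  refine ⟨|deriv (deriv φ) x₀| + 1, K, by positivity, K.2, ε, hε, fun x hxI => ?_⟩
  refine ⟨(hφ.contDiffAt (hU.mem_nhds (hball hxI).1.1)).differentiableAt (by norm_num),
    le_of_lt (hball hxI).2, fun y hyI => ?_⟩
  have hsub : uIcc x y ⊆ Ioo (x₀ - ε) (x₀ + ε) := by
    intro u hu
    exact OrdConnected.uIcc_subset inferInstance hxI hyI hu
  have hmv := Convex.norm_image_sub_le_of_norm_hasDerivWithin_le
    (f := fun u => deriv φ u - deriv (deriv φ) x * u)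
    (f' := fun u => deriv (deriv φ) u - deriv (deriv φ) x) (s := uIcc x y) (x := x) (y := y)
    (C := K * |y - x|) ?_ ?_ (convex_uIcc x y) left_mem_uIcc right_mem_uIcc
  · rw [Real.norm_eq_abs, Real.norm_eq_abs, mul_assoc, ← abs_mul, abs_mul_self] at hmv
    have e : deriv φ y - deriv φ x - deriv (deriv φ) x * (y - x) =
        deriv φ y - deriv (deriv φ) x * y - (deriv φ x - deriv (deriv φ) x * x) := by ring
    rw [e, pow_two]
    exact hmv
  · intro u hu
    have hd : DifferentiableAt ℝ (deriv φ) u :=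
      (h2.contDiffAt (hU.mem_nhds (hball (hsub hu)).1.1)).differentiableAt (by norm_num)
    refine HasDerivAt.hasDerivWithinAt ?_
    exact (hd.hasDerivAt.sub ((hasDerivAt_id u).const_mul (deriv (deriv φ) x))).congr_deriv
      (by simp)
  · intro u hu
    have := hK.dist_le_mul u (hball (hsub hu)).1.2 x (hball hxI).1.2
    rw [Real.dist_eq, Real.dist_eq] at this
    rw [Real.norm_eq_abs]
    exact this.trans (mul_le_mul_of_nonneg_left (abs_sub_left_of_mem_uIcc hu) K.2)

lemma abs_mul_sub_mul_le {q r M K L ab ac bd cd : ℝ} (hq : |q| ≤ M) (hL : 0 ≤ L)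
    (h1 : |ac - q| ≤ L * r) (h2 : |bd - q| ≤ L * r)
    (h3 : |ab - q| ≤ L * r) (h4 : |cd - q| ≤ L * r) (hr : 0 ≤ r)
    (h5 : |ac + bd - ab - cd| ≤ 4 * K * r ^ 2) :
    |ac * bd - ab * cd| ≤ (4 * K * M + 2 * L ^ 2) * r ^ 2 := by
  have e : ac * bd - ab * cd = q * (ac + bd - ab - cd) + ((ac - q) * (bd - q)
      - (ab - q) * (cd - q)) := by ring
  have hLr : 0 ≤ L * r := by positivity
  have i1 : |q * (ac + bd - ab - cd)| ≤ M * (4 * K * r ^ 2) := by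
    rw [abs_mul]
    exact mul_le_mul hq h5 (abs_nonneg _) ((abs_nonneg _).trans hq)
  have i2 : |(ac - q) * (bd - q)| ≤ (L * r) * (L * r) := by
    rw [abs_mul]
    exact mul_le_mul h1 h2 (abs_nonneg _) hLr
  have i3 : |(ab - q) * (cd - q)| ≤ (L * r) * (L * r) := by
    rw [abs_mul]
    exact mul_le_mul h3 h4 (abs_nonneg _) hLr
  rw [e]
  refine (abs_add_le _ _).trans ?_
  have := abs_sub ((ac - q) * (bd - q)) ((ab - q) * (cd - q))
  nlinarith

lemma exp_mul_le_of_abs_sub_le {X X' P Q t e : ℝ} (hX : 0 < X) (h : X' * Q = X * P)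
    (he : 0 < e) (hQ : e ≤ Q) (hP : e ≤ P) (hd : |P - Q| ≤ t * e) (ht : 0 ≤ t)
    (ht' : t ≤ 1 / 2) :
    Real.exp (-(2 * t)) * X ≤ X' ∧ Real.exp (-(2 * t)) * X' ≤ X := by
  have hexp := exp_neg_two_mul_le ht ht'
  have q1 : 0 < Q := he.trans_le hQ
  have q2 : 0 < P := he.trans_le hP
  have k1 : t * e ≤ t * Q := mul_le_mul_of_nonneg_left hQ ht
  have k2 : t * e ≤ t * P := mul_le_mul_of_nonneg_left hP ht
  have hbds := abs_le.1 hd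
  have hX' : X' = X * P / Q := by rw [← h, mul_div_cancel_right₀ _ q1.ne']
  have hX0 : 0 < X' := by rw [hX']; positivity
  constructor
  · refine (mul_le_mul_of_nonneg_right hexp hX.le).trans ?_
    rw [hX', le_div_iff₀ q1, show (1 - t) * X * Q = X * ((1 - t) * Q) by ring]
    refine mul_le_mul_of_nonneg_left ?_ hX.le
    linarith [hbds.1]
  · refine (mul_le_mul_of_nonneg_right hexp hX0.le).trans ?_
    refine le_of_mul_le_mul_right ?_ q2
    rw [← h, show (1 - t) * X' * P = X' * ((1 - t) * P) by ring]
    refine mul_le_mul_of_nonneg_left ?_ hX0.le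
    linarith [hbds.2]

set_option maxHeartbeats 1000000 in
/-- A `C³` function with positive derivative is locally bi-Lipschitz and distorts cross-ratios
by a factor which is quadratic in the size of the interval. -/
lemma exists_crossRatio_distortion {φ : ℝ → ℝ} {U : Set ℝ} {x₀ : ℝ} (hU : IsOpen U) (hx : x₀ ∈ U)
    (hφ : ContDiffOn ℝ 3 φ U) (hd : 0 < deriv φ x₀) :
    ∃ m M C : ℝ, 0 < m ∧ 0 < M ∧ 0 ≤ C ∧ ∃ ε > 0, Ioo (x₀ - ε) (x₀ + ε) ⊆ U ∧
      (∀ x ∈ Ioo (x₀ - ε) (x₀ + ε), ∀ y ∈ Ioo (x₀ - ε) (x₀ + ε), x ≤ y →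
        m * (y - x) ≤ φ y - φ x ∧ φ y - φ x ≤ M * (y - x)) ∧
      (∀ a ∈ Ioo (x₀ - ε) (x₀ + ε), ∀ d ∈ Ioo (x₀ - ε) (x₀ + ε), ∀ b c, a < b → b < c → c < d →
        Real.exp (-(C * (d - a) ^ 2)) * crossRatio a b c d ≤
          crossRatio (φ a) (φ b) (φ c) (φ d) ∧
        Real.exp (-(C * (d - a) ^ 2)) * crossRatio (φ a) (φ b) (φ c) (φ d) ≤
          crossRatio a b c d) := by
  obtain ⟨B, K, hB, hK, ε₁, hε₁, htay⟩ := exists_taylor_deriv hU hx hφ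
  have h2 : ContDiffOn ℝ 2 (deriv φ) U :=
    ((contDiffOn_succ_iff_deriv_of_isOpen (n := 2) hU).1 (by exact_mod_cast hφ)).2.2
  have hcont : ContinuousAt (deriv φ) x₀ := (h2.contDiffAt (hU.mem_nhds hx)).continuousAt
  set m := deriv φ x₀ / 2 with hm
  set M := 2 * deriv φ x₀ with hM
  have hm0 : 0 < m := by positivity
  have hM0 : 0 < M := by positivity
  set C := (4 * K * M + 2 * (B + K) ^ 2) / m ^ 2 with hC
  have hC0 : 0 ≤ C := by positivity
  have hev : ∀ᶠ x in nhds x₀, m < deriv φ x ∧ deriv φ x < M := by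
    refine (hcont.eventually_const_lt ?_).and (hcont.eventually_lt_const ?_)
    · rw [hm]; linarith
    · rw [hM]; linarith
  obtain ⟨ε₂, hε₂, hball⟩ := Metric.mem_nhds_iff.1 (inter_mem (hU.mem_nhds hx) hev)
  rw [Real.ball_eq_Ioo] at hball
  obtain ⟨ε₃, hε₃, hCε⟩ : ∃ ε₃ > 0, C * (2 * ε₃) ≤ 1 / 2 := by
    refine ⟨1 / (4 * (C + 1)), by positivity, ?_⟩
    rw [show C * (2 * (1 / (4 * (C + 1)))) = C / (C + 1) / 2 by field_simp; ring]
    have : C / (C + 1) ≤ 1 := (div_le_one (by positivity)).2 (by linarith)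
    linarith
  set ε := min (min ε₁ ε₂) (min ε₃ (1 / 2)) with hε
  have hε0 : 0 < ε := by positivity
  have l1 : ε ≤ ε₁ := (min_le_left _ _).trans (min_le_left _ _)
  have l2 : ε ≤ ε₂ := (min_le_left _ _).trans (min_le_right _ _)
  have l3 : ε ≤ ε₃ := (min_le_right _ _).trans (min_le_left _ _)
  have l4 : ε ≤ 1 / 2 := (min_le_right _ _).trans (min_le_right _ _)
  have s1 : Ioo (x₀ - ε) (x₀ + ε) ⊆ Ioo (x₀ - ε₁) (x₀ + ε₁) :=
    Ioo_subset_Ioo (by linarith) (by linarith)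
  have s2 : Ioo (x₀ - ε) (x₀ + ε) ⊆ Ioo (x₀ - ε₂) (x₀ + ε₂) :=
    Ioo_subset_Ioo (by linarith) (by linarith)
  have hbilip : ∀ x ∈ Ioo (x₀ - ε) (x₀ + ε), ∀ y ∈ Ioo (x₀ - ε) (x₀ + ε), x ≤ y →
        m * (y - x) ≤ φ y - φ x ∧ φ y - φ x ≤ M * (y - x) := by
    intro x hx y hy hxy
    have hdiff : ∀ u ∈ Ioo (x₀ - ε) (x₀ + ε), DifferentiableAt ℝ φ u :=
      fun u hu => (htay u (s1 hu)).1
    constructor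
    · refine (convex_Ioo _ _).mul_sub_le_image_sub_of_le_deriv ?_ ?_ ?_ x hx y hy hxy
      · exact fun u hu => (hdiff u hu).continuousAt.continuousWithinAt
      · rw [interior_Ioo]; exact fun u hu => (hdiff u hu).differentiableWithinAt
      · rw [interior_Ioo]; exact fun u hu => (hball (s2 hu)).2.1.le
    · refine (convex_Ioo _ _).image_sub_le_mul_sub_of_deriv_le ?_ ?_ ?_ x hx y hy hxy
      · exact fun u hu => (hdiff u hu).continuousAt.continuousWithinAt
      · rw [interior_Ioo]; exact fun u hu => (hdiff u hu).differentiableWithinAt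
      · rw [interior_Ioo]; exact fun u hu => (hball (s2 hu)).2.2.le
  refine ⟨m, M, 2 * C, hm0, hM0, by positivity, ε, hε0, fun x hx => (hball (s2 hx)).1, hbilip, ?_⟩
  intro a ha d hdI b c hab hbc hcd
  have hrad : d - a < 2 * ε := by have := ha.1; have := hdI.2; linarith
  set r := d - a with hr
  have hr0 : 0 < r := by rw [hr]; linarith
  have hr1 : r ≤ 1 := by linarith
  have hsub : Icc a d ⊆ Ioo (x₀ - ε) (x₀ + ε) := fun u hu =>
    ⟨lt_of_lt_of_le ha.1 hu.1, lt_of_le_of_lt hu.2 hdI.2⟩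
  set q := deriv φ a with hq
  set q2 := deriv (deriv φ) a with hq2
  have hq2B : |q2| ≤ B := (htay a (s1 ha)).2.1
  have hqM : |q| ≤ M := by
    have := (hball (s2 ha)).2
    rw [abs_of_pos (hm0.trans this.1)]; exact this.2.le
  have hslope : ∀ x ∈ Icc a d, ∀ y ∈ Icc a d, x < y →
      |(φ y - φ x) / (y - x) - q - q2 * ((x + y) / 2 - a)| ≤ K * r ^ 2 := by
    intro x hx y hy hxy
    have hmv := Convex.norm_image_sub_le_of_norm_hasDerivWithin_le
      (f := fun u => φ u - q * u - q2 * ((u - a) ^ 2 / 2))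
      (f' := fun u => deriv φ u - q - q2 * (u - a)) (s := Icc a d) (x := x) (y := y)
      (C := K * r ^ 2) ?_ ?_ (convex_Icc a d) hx hy
    · rw [Real.norm_eq_abs, Real.norm_eq_abs, abs_of_pos (sub_pos.2 hxy)] at hmv
      have e : (φ y - φ x) / (y - x) - q - q2 * ((x + y) / 2 - a) =
          (φ y - q * y - q2 * ((y - a) ^ 2 / 2) - (φ x - q * x - q2 * ((x - a) ^ 2 / 2)))
            / (y - x) := by
        have := (sub_pos.2 hxy).ne'
        field_simp
        ring
      rw [e, abs_div, abs_of_pos (sub_pos.2 hxy), div_le_iff₀ (sub_pos.2 hxy)]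
      exact hmv
    · intro u hu
      refine HasDerivAt.hasDerivWithinAt ?_
      have h1 := ((htay u (s1 (hsub hu))).1.hasDerivAt.sub ((hasDerivAt_id u).const_mul q)).sub
        (((((hasDerivAt_id u).sub_const a).pow 2).div_const 2).const_mul q2)
      refine h1.congr_deriv ?_
      simp
    · intro u hu
      rw [Real.norm_eq_abs]
      refine ((htay a (s1 ha)).2.2 u (s1 (hsub hu))).trans ?_
      have : (u - a) ^ 2 ≤ r ^ 2 := by
        have h1 : 0 ≤ u - a := by linarith [hu.1]
        have h2 : u - a ≤ r := by linarith [hu.2]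
        nlinarith
      gcongr
  have ma : a ∈ Icc a d := ⟨le_rfl, by linarith⟩
  have mb : b ∈ Icc a d := ⟨by linarith, by linarith⟩
  have mc : c ∈ Icc a d := ⟨by linarith, by linarith⟩
  have md : d ∈ Icc a d := ⟨by linarith, le_rfl⟩
  have hdev : ∀ x ∈ Icc a d, ∀ y ∈ Icc a d, x < y →
      |(φ y - φ x) / (y - x) - q| ≤ (B + K) * r := by
    intro x hx y hy hxy
    have h := hslope x hx y hy hxy
    have h' : |q2 * ((x + y) / 2 - a)| ≤ B * r := by
      rw [abs_mul]
      have : |(x + y) / 2 - a| ≤ r := by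
        rw [abs_of_nonneg (by linarith [hx.1, hy.1])]
        linarith [hx.2, hy.2]
      exact mul_le_mul hq2B this (abs_nonneg _) hB
    have e : (φ y - φ x) / (y - x) - q = ((φ y - φ x) / (y - x) - q - q2 * ((x + y) / 2 - a))
      + q2 * ((x + y) / 2 - a) := by ring
    rw [e]
    refine (abs_add_le _ _).trans ?_
    have : K * r ^ 2 ≤ K * r := by
      have : r ^ 2 ≤ r := by nlinarith
      gcongr
    nlinarith
  have hms : ∀ x ∈ Icc a d, ∀ y ∈ Icc a d, x < y → m ≤ (φ y - φ x) / (y - x) := by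
    intro x hx y hy hxy
    rw [le_div_iff₀ (sub_pos.2 hxy)]
    exact (hbilip x (hsub hx) y (hsub hy) hxy.le).1
  have hac := hab.trans hbc
  have hbd := hbc.trans hcd
  set Sab := (φ b - φ a) / (b - a) with hSab
  set Sac := (φ c - φ a) / (c - a) with hSac
  set Sbd := (φ d - φ b) / (d - b) with hSbd
  set Scd := (φ d - φ c) / (d - c) with hScd
  have hdiff : |Sac * Sbd - Sab * Scd| ≤ (4 * K * M + 2 * (B + K) ^ 2) * r ^ 2 := by
    refine abs_mul_sub_mul_le hqM (by positivity) (hdev a ma c mc hac) (hdev b mb d md hbd)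
      (hdev a ma b mb hab) (hdev c mc d md hcd) hr0.le ?_
    have e1 := abs_le.1 (hslope a ma c mc hac)
    have e2 := abs_le.1 (hslope b mb d md hbd)
    have e3 := abs_le.1 (hslope a ma b mb hab)
    have e4 := abs_le.1 (hslope c mc d md hcd)
    rw [← hSac] at e1; rw [← hSbd] at e2; rw [← hSab] at e3; rw [← hScd] at e4
    rw [abs_le]
    constructor <;> linarith
  have pab := hms a ma b mb hab
  have pac := hms a ma c mc hac
  have pbd := hms b mb d md hbd
  have pcd := hms c mc d md hcd
  rw [← hSab] at pab; rw [← hSac] at pac; rw [← hSbd] at pbd; rw [← hScd] at pcd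
  have hnum : (4 * K * M + 2 * (B + K) ^ 2) * r ^ 2 = C * r ^ 2 * m ^ 2 := by
    rw [hC]; field_simp
  rw [hnum] at hdiff
  have hCr0 : 0 ≤ C * r ^ 2 := by positivity
  have hCr : C * r ^ 2 ≤ 1 / 2 := by
    have h1 : r ^ 2 ≤ 2 * ε₃ := by nlinarith
    exact (mul_le_mul_of_nonneg_left h1 hC0).trans hCε
  have hexp := exp_neg_two_mul_le hCr0 hCr
  have hbase : crossRatio (φ a) (φ b) (φ c) (φ d) * (Sab * Scd) =
      crossRatio a b c d * (Sac * Sbd) := by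
    have i1 := (sub_pos.2 hab).ne'; have i2 := (sub_pos.2 hcd).ne'
    have i3 := (sub_pos.2 hac).ne'; have i4 := (sub_pos.2 hbd).ne'
    have j1 : φ b - φ a ≠ 0 := by
      intro h; rw [hSab, h, zero_div] at pab; linarith
    have j2 : φ d - φ c ≠ 0 := by
      intro h; rw [hScd, h, zero_div] at pcd; linarith
    rw [hSab, hScd, hSac, hSbd]
    unfold crossRatio
    field_simp
  have P1 : m ^ 2 ≤ Sab * Scd := by
    rw [pow_two]
    exact mul_le_mul pab pcd hm0.le (hm0.le.trans pab)
  have P2 : m ^ 2 ≤ Sac * Sbd := by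
    rw [pow_two]
    exact mul_le_mul pac pbd hm0.le (hm0.le.trans pac)
  rw [show -(2 * C * r ^ 2) = -(2 * (C * r ^ 2)) by ring]
  exact exp_mul_le_of_abs_sub_le (crossRatio_pos hab hbc hcd) hbase (pow_pos hm0 2) P1 P2 hdiff
    hCr0 hCr

/-- The lifts to `ℝ` of the critical points. -/
def MulticriticalCircleMap.critLift (f : MulticriticalCircleMap) : Set ℝ :=
  {x | ∃ (i : Fin f.N) (k : ℤ), x = f.crit i + k}

lemma add_int_of_add_one {G : ℝ → ℝ} (hG : ∀ x, G (x + 1) = G x + 1) (x : ℝ) (k : ℤ) :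
    G (x + k) = G x + k := by
  induction k using Int.induction_on with
  | zero => simp
  | succ n ih => push_cast at ih ⊢; rw [← add_assoc, hG, ih]; ring
  | pred n ih =>
    have := hG (x + ((-n - 1 : ℤ) : ℝ))
    push_cast at ih this ⊢
    rw [show x + (-(n : ℝ) - 1) + 1 = x + -(n : ℝ) by ring, ih] at this
    linarith

lemma exists_le_sub_of_strictMono {G : ℝ → ℝ} (hm : StrictMono G) (hc : Continuous G)
    (hG : ∀ x, G (x + 1) = G x + 1) {η : ℝ} (hη : 0 < η) :
    ∃ δ > 0, ∀ x, δ ≤ G (x + η) - G x := by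
  obtain ⟨x₀, -, hx₀⟩ := isCompact_Icc.exists_isMinOn (nonempty_Icc.2 (zero_le_one' ℝ))
    (f := fun x => G (x + η) - G x) (by fun_prop)
  refine ⟨G (x₀ + η) - G x₀, sub_pos.2 (hm (by linarith)), fun x => ?_⟩
  have h1 := add_int_of_add_one hG (Int.fract x) ⌊x⌋
  have h2 := add_int_of_add_one hG (Int.fract x + η) ⌊x⌋
  rw [Int.fract_add_floor] at h1
  rw [add_right_comm, Int.fract_add_floor] at h2
  have := hx₀ ⟨Int.fract_nonneg x, (Int.fract_lt_one x).le⟩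
  change G (x₀ + η) - G x₀ ≤ G (Int.fract x + η) - G (Int.fract x) at this
  linarith

/-- Local-to-global principle for monotone families of periodic relations on short intervals. -/
lemma exists_uniform_of_local {R : ℕ → ℝ → ℝ → Prop}
    (hmono : ∀ n m a d, n ≤ m → a ≤ d → R n a d → R m a d)
    (hper : ∀ n a d, ∀ k : ℤ, R n a d → R n (a + k) (d + k))
    (hloc : ∀ x, ∃ n, ∃ ε > 0, ∀ a d, x - ε < a → a ≤ d → d < x + ε → R n a d) :
    ∃ n, ∃ ε > 0, ∀ a d, a ≤ d → d - a < ε → R n a d := by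
  have key : ∃ n, ∃ ε > 0, ∀ x ∈ Icc (0 : ℝ) 1, ∀ a d, x - ε < a → a ≤ d → d < x + ε →
      R n a d := by
    refine isCompact_Icc.induction_on (p := fun s => ∃ n, ∃ ε > 0, ∀ x ∈ s, ∀ a d,
      x - ε < a → a ≤ d → d < x + ε → R n a d) ⟨0, 1, one_pos, by simp⟩ ?_ ?_ ?_
    · rintro s t hst ⟨n, ε, hε, h⟩
      exact ⟨n, ε, hε, fun x hx => h x (hst hx)⟩
    · rintro s t ⟨n, ε, hε, h⟩ ⟨m, ε', hε', h'⟩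
      refine ⟨max n m, min ε ε', lt_min hε hε', fun x hx a d h1 h2 h3 => ?_⟩
      have l1 := min_le_left ε ε'
      have l2 := min_le_right ε ε'
      rcases hx with hx | hx
      · exact hmono _ _ _ _ (le_max_left _ _) h2 (h x hx a d (by linarith) h2 (by linarith))
      · exact hmono _ _ _ _ (le_max_right _ _) h2 (h' x hx a d (by linarith) h2 (by linarith))
    · intro x _
      obtain ⟨n, ε, hε, h⟩ := hloc x
      refine ⟨Ioo (x - ε / 2) (x + ε / 2), mem_nhdsWithin_of_mem_nhds
        (Ioo_mem_nhds (by linarith) (by linarith)), n, ε / 2, by positivity, ?_⟩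
      intro y hy a d h1 h2 h3
      exact h a d (by linarith [hy.1]) h2 (by linarith [hy.2])
  obtain ⟨n, ε, hε, h⟩ := key
  refine ⟨n, ε, hε, fun a d had hda => ?_⟩
  have := hper n _ _ ⌊a⌋ (h (Int.fract a) ⟨Int.fract_nonneg a, (Int.fract_lt_one a).le⟩
    (Int.fract a) (d - ⌊a⌋) (by linarith) (by rw [Int.fract]; linarith)
    (by rw [Int.fract]; linarith))
  rwa [Int.fract_add_floor, sub_add_cancel] at this

lemma CircleHomeo.deriv_pos_of_conj {H : CircleHomeo} {c p : ℝ} {U U' : Set ℝ} {φ ψ : ℝ → ℝ}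
    (hp : 1 < p) (hU : IsOpen U) (hc : c ∈ U) (hU' : IsOpen U') (hc' : H.lift c ∈ U')
    (hφ : ContDiffOn ℝ 3 φ U) (hψ : ContDiffOn ℝ 3 ψ U') (hφc : φ c = 0)
    (hd : 0 < deriv φ c) (hd' : deriv ψ (H.lift c) ≠ 0)
    (h : ∀ x ∈ U, ψ (H.lift x) = oddPow p (φ x)) : 0 < deriv ψ (H.lift c) := by
  by_contra hneg
  have hneg' : 0 < deriv (fun y => -ψ y) (H.lift c) := by
    rw [deriv.fun_neg]
    rcases lt_or_gt_of_ne hd' with h | h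
    · linarith
    · exact absurd h hneg
  obtain ⟨m, M, C, hm, -, -, ε, hε, hsub, hlip, -⟩ := exists_crossRatio_distortion hU hc hφ hd
  obtain ⟨m', M', C', hm', -, -, ε', hε', hsub', hlip', -⟩ :=
    exists_crossRatio_distortion hU' hc' hψ.neg hneg'
  have ev : ∀ᶠ x in nhdsWithin c (Ioi c), x ∈ Ioo (c - ε) (c + ε) ∧
      H.lift x ∈ Ioo (H.lift c - ε') (H.lift c + ε') ∧ c < x := by
    have h1 : ∀ᶠ x in nhds c, x ∈ Ioo (c - ε) (c + ε) :=
      Ioo_mem_nhds (by linarith) (by linarith)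
    have h2 : ∀ᶠ x in nhds c, H.lift x ∈ Ioo (H.lift c - ε') (H.lift c + ε') :=
      H.lift_continuous.continuousAt.eventually (Ioo_mem_nhds (by linarith) (by linarith))
    exact (h1.filter_mono nhdsWithin_le_nhds).and
      ((h2.filter_mono nhdsWithin_le_nhds).and self_mem_nhdsWithin)
  obtain ⟨x, hx, hFx, hcx⟩ := ev.exists
  have h1 := (hlip c ⟨by linarith, by linarith⟩ x hx hcx.le).1
  have h2 := (hlip' _ ⟨by linarith, by linarith⟩ _ hFx (H.lift_strictMono hcx).le).1
  have h3 : 0 < m * (x - c) := mul_pos hm (sub_pos.2 hcx)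
  have h4 : 0 < m' * (H.lift x - H.lift c) := mul_pos hm' (sub_pos.2 (H.lift_strictMono hcx))
  rw [h x (hsub hx), h c hc, hφc, oddPow_zero] at h2
  have h5 := oddPow_strictMono hp (show 0 < φ x by linarith)
  rw [oddPow_zero] at h5
  linarith

lemma IsPowerLawCritPt.exists_normal_form {H : CircleHomeo} {c p : ℝ} (hp : 1 < p)
    (h : IsPowerLawCritPt H c p) :
    ∃ (U U' : Set ℝ) (φ ψ : ℝ → ℝ), IsOpen U ∧ c ∈ U ∧ IsOpen U' ∧ H.lift c ∈ U' ∧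
      ContDiffOn ℝ 3 φ U ∧ ContDiffOn ℝ 3 ψ U' ∧ 0 < deriv φ c ∧ 0 < deriv ψ (H.lift c) ∧
      φ c = 0 ∧ ∀ x ∈ U, ψ (H.lift x) = oddPow p (φ x) := by
  obtain ⟨U, V, U', V', φ, ψ, hc, hc', -, -, ⟨hU, -, hφ, -, hdφ⟩, ⟨hU', -, hψ, -, hdψ⟩, hφc, -, -,
    hconj⟩ := h
  rcases lt_or_gt_of_ne (hdφ c hc) with hneg | hpos
  · have hpos : 0 < deriv (fun y => -φ y) c := by
      rw [deriv.fun_neg]; linarith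
    have hconj' : ∀ x ∈ U, -ψ (H.lift x) = oddPow p (-φ x) := fun x hx => by
      rw [oddPow_neg, hconj x hx, oddPow]
    have hne : deriv (fun y => -ψ y) (H.lift c) ≠ 0 := by
      rw [deriv.fun_neg]; exact neg_ne_zero.2 (hdψ _ hc')
    exact ⟨U, U', fun y => -φ y, fun y => -ψ y, hU, hc, hU', hc', hφ.neg, hψ.neg, hpos,
      H.deriv_pos_of_conj hp hU hc hU' hc' hφ.neg hψ.neg (by simp [hφc]) hpos hne hconj',
      by simp [hφc], hconj'⟩
  · exact ⟨U, U', φ, ψ, hU, hc, hU', hc', hφ, hψ, hpos,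
      H.deriv_pos_of_conj hp hU hc hU' hc' hφ hψ hφc hpos (hdψ _ hc') hconj, hφc, hconj⟩

/-- A circle homeomorphism of class `C¹` is Lipschitz. -/
lemma CircleHomeo.exists_lipschitz (H : CircleHomeo) (hH : ContDiff ℝ 1 H.lift) :
    ∃ L > 0, ∀ a d, a ≤ d → d ≤ a + 1 → H.lift d - H.lift a ≤ L * (d - a) := by
  have key : ∃ n : ℕ, ∃ ε > 0, ∀ a d, a ≤ d → d - a < ε →
      H.lift d - H.lift a ≤ n * (d - a) := by
    refine exists_uniform_of_local (R := fun n a d => H.lift d - H.lift a ≤ n * (d - a)) ?_ ?_ ?_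
    · intro n m a d hnm had hR
      refine hR.trans (mul_le_mul_of_nonneg_right (by exact_mod_cast hnm) (by linarith))
    · intro n a d k hR
      rw [add_int_of_add_one H.lift_add_one, add_int_of_add_one H.lift_add_one]
      linarith
    · intro x
      obtain ⟨K, t, ht, hK⟩ := (hH.contDiffAt (x := x)).exists_lipschitzOnWith
      obtain ⟨ε, hε, hball⟩ := Metric.mem_nhds_iff.1 ht
      rw [Real.ball_eq_Ioo] at hball
      obtain ⟨n, hn⟩ := exists_nat_ge (K : ℝ)
      refine ⟨n, ε, hε, fun a d h1 h2 h3 => ?_⟩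
      have := hK.dist_le_mul d (hball ⟨by linarith, h3⟩) a (hball ⟨h1, by linarith⟩)
      rw [Real.dist_eq, Real.dist_eq, abs_of_nonneg (sub_nonneg.2 h2)] at this
      exact (le_abs_self _).trans (this.trans (mul_le_mul_of_nonneg_right hn (by linarith)))
  obtain ⟨n, ε, hε, h⟩ := key
  refine ⟨max n (1 / ε), lt_max_of_lt_right (by positivity), fun a d had hd => ?_⟩
  have hda : 0 ≤ d - a := by linarith
  rcases lt_or_ge (d - a) ε with h1 | h1
  · exact (h a d had h1).trans (mul_le_mul_of_nonneg_right (le_max_left _ _) hda)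
  · have h2 := H.lift_strictMono.monotone hd
    rw [H.lift_add_one] at h2
    have h3 : 1 ≤ 1 / ε * (d - a) := by
      rw [one_div, inv_mul_eq_div, one_le_div hε]; exact h1
    have := mul_le_mul_of_nonneg_right (le_max_right (n : ℝ) (1 / ε)) hda
    linarith

/-- Average slopes over subintervals of `[a, d]` are at most `n` times the slope on `[a, d]`. -/
def SlopeBound (G : ℝ → ℝ) (n a d : ℝ) : Prop :=
  ∀ b c, a ≤ b → b ≤ c → c ≤ d → (G c - G b) * (d - a) ≤ n * ((G d - G a) * (c - b))

lemma SlopeBound.mono {G : ℝ → ℝ} (hG : Monotone G) {n m a d : ℝ} (hnm : n ≤ m)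
    (h : SlopeBound G n a d) : SlopeBound G m a d := by
  intro b c h1 h2 h3
  refine (h b c h1 h2 h3).trans (mul_le_mul_of_nonneg_right hnm (mul_nonneg ?_ ?_))
  · exact sub_nonneg.2 (hG (h1.trans (h2.trans h3)))
  · exact sub_nonneg.2 h2

lemma SlopeBound.add_int {G : ℝ → ℝ} (hG : ∀ x, G (x + 1) = G x + 1) {n a d : ℝ} (k : ℤ)
    (h : SlopeBound G n a d) : SlopeBound G n (a + k) (d + k) := by
  intro b c h1 h2 h3
  have := h (b - k) (c - k) (by linarith) (by linarith) (by linarith)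
  have e1 := add_int_of_add_one hG (b - k) k
  have e2 := add_int_of_add_one hG (c - k) k
  rw [sub_add_cancel] at e1 e2
  rw [add_int_of_add_one hG, add_int_of_add_one hG, e1, e2]
  calc _ = (G (c - k) - G (b - k)) * (d - a) := by ring
    _ ≤ _ := this
    _ = _ := by ring

lemma IsPowerLawCritPt.exists_local_bounds {H : CircleHomeo} (hH : ContDiff ℝ 1 H.lift) {c p : ℝ}
    (hp : 1 < p) (h : IsPowerLawCritPt H c p) :
    ∃ C ≥ 0, ∃ ε > 0,
      (∀ a d, c - ε < a → a ≤ d → d < c + ε → SlopeBound H.lift C a d) ∧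
      (∀ a b e d, c - ε < a → a < b → b < e → e < d → d < c + ε → ¬ (a < c ∧ c < d) →
        Real.exp (-(C * (d - a) ^ 2)) * crossRatio a b e d ≤
          crossRatio (H.lift a) (H.lift b) (H.lift e) (H.lift d)) ∧
      (∀ K > 0, ∃ η > 0, ∀ b e d, c < b → b < e → e < d → d < c + ε → b - c ≤ K * (e - b) →
        (1 + η) * Real.exp (-(C * (d - c) ^ 2)) * crossRatio c b e d ≤
          crossRatio (H.lift c) (H.lift b) (H.lift e) (H.lift d)) := by
  obtain ⟨L, hL, hLip⟩ := H.exists_lipschitz hH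
  obtain ⟨U, U', φ, ψ, hU, hc, hU', hc', hφ, hψ, hdφ, hdψ, hφc, hconj⟩ := h.exists_normal_form hp
  obtain ⟨m, M, C, hm, hM, hC, ε, hε, hsub, hlip, hdist⟩ :=
    exists_crossRatio_distortion hU hc hφ hdφ
  obtain ⟨m', M', C', hm', hM', hC', ε', hε', hsub', hlip', hdist'⟩ :=
    exists_crossRatio_distortion hU' hc' hψ hdψ
  have ev : ∀ᶠ x in nhds c, x ∈ Ioo (c - ε) (c + ε) ∧
      H.lift x ∈ Ioo (H.lift c - ε') (H.lift c + ε') ∧ x ∈ Ioo (c - 1 / 2) (c + 1 / 2) :=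
    (show ∀ᶠ x in nhds c, x ∈ Ioo (c - ε) (c + ε) from
      Ioo_mem_nhds (by linarith) (by linarith)).and
    ((H.lift_continuous.continuousAt.eventually
      (Ioo_mem_nhds (a := H.lift c - ε') (b := H.lift c + ε') (by linarith) (by linarith))).and
      (show ∀ᶠ x in nhds c, x ∈ Ioo (c - 1 / 2) (c + 1 / 2) from
        Ioo_mem_nhds (by linarith) (by linarith)))
  obtain ⟨ε₀, hε₀, hball⟩ := Metric.mem_nhds_iff.1 ev
  rw [Real.ball_eq_Ioo] at hball
  have hmono := H.lift_strictMono
  have hφmono : ∀ x ∈ Ioo (c - ε₀) (c + ε₀), ∀ y ∈ Ioo (c - ε₀) (c + ε₀), x < y → φ x < φ y := by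
    intro x hx y hy hxy
    have h1 := (hlip x (hball hx).1 y (hball hy).1 hxy.le).1
    have h2 := mul_pos hm (sub_pos.2 hxy)
    linarith
  have chain : ∀ s ≥ 0, ∀ a b e d, c - ε₀ < a → a < b → b < e → e < d → d < c + ε₀ →
      s * crossRatio (φ a) (φ b) (φ e) (φ d) ≤
        crossRatio (oddPow p (φ a)) (oddPow p (φ b)) (oddPow p (φ e)) (oddPow p (φ d)) →
      s * Real.exp (-((C + C' * L ^ 2) * (d - a) ^ 2)) * crossRatio a b e d ≤
          crossRatio (H.lift a) (H.lift b) (H.lift e) (H.lift d) := by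
    intro s hs a b e d ha hab hbe hed hd hX
    have ma : a ∈ Ioo (c - ε₀) (c + ε₀) := ⟨ha, by linarith⟩
    have mb : b ∈ Ioo (c - ε₀) (c + ε₀) := ⟨by linarith, by linarith⟩
    have me : e ∈ Ioo (c - ε₀) (c + ε₀) := ⟨by linarith, by linarith⟩
    have md : d ∈ Ioo (c - ε₀) (c + ε₀) := ⟨by linarith, by linarith⟩
    have i1 := (hdist a (hball ma).1 d (hball md).1 b e hab hbe hed).1
    have i2 := (hdist' _ (hball ma).2.1 _ (hball md).2.1 _ _ (hmono hab) (hmono hbe)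
      (hmono hed)).2
    rw [hconj a (hsub (hball ma).1), hconj b (hsub (hball mb).1), hconj e (hsub (hball me).1),
      hconj d (hsub (hball md).1)] at i2
    have i3 : Real.exp (-(C' * (L * (d - a)) ^ 2)) ≤
        Real.exp (-(C' * (H.lift d - H.lift a) ^ 2)) := by
      refine Real.exp_le_exp.2 (neg_le_neg (mul_le_mul_of_nonneg_left ?_ hC'))
      refine pow_le_pow_left₀ (sub_nonneg.2 (hmono.monotone (by linarith))) ?_ 2
      refine hLip a d (by linarith) ?_
      have := (hball ma).2.2.1
      have := (hball md).2.2.2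
      linarith
    have e1 : Real.exp (-((C + C' * L ^ 2) * (d - a) ^ 2)) =
        Real.exp (-(C' * (L * (d - a)) ^ 2)) * Real.exp (-(C * (d - a) ^ 2)) := by
      rw [← Real.exp_add]; ring_nf
    rw [e1]
    have hpow := oddPow_strictMono hp
    calc _ = Real.exp (-(C' * (L * (d - a)) ^ 2)) * (s * (Real.exp (-(C * (d - a) ^ 2)) *
          crossRatio a b e d)) := by ring
      _ ≤ Real.exp (-(C' * (L * (d - a)) ^ 2)) * (s * crossRatio (φ a) (φ b) (φ e) (φ d)) := by
          gcongr
      _ ≤ Real.exp (-(C' * (L * (d - a)) ^ 2)) * crossRatio (oddPow p (φ a)) (oddPow p (φ b))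
          (oddPow p (φ e)) (oddPow p (φ d)) := by gcongr
      _ ≤ _ := by
          refine le_trans ?_ i2
          refine mul_le_mul_of_nonneg_right i3 (crossRatio_pos ?_ ?_ ?_).le
          · exact hpow (hφmono a ma b mb hab)
          · exact hpow (hφmono b mb e me hbe)
          · exact hpow (hφmono e me d md hed)
  have slope : ∀ a d, c - ε₀ < a → a ≤ d → d < c + ε₀ →
      SlopeBound H.lift (2 * p * M' * M / (m' * m)) a d := by
    intro a d ha had hd b e hab hbe hed
    have ma : a ∈ Ioo (c - ε₀) (c + ε₀) := ⟨ha, by linarith⟩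
    have mb : b ∈ Ioo (c - ε₀) (c + ε₀) := ⟨by linarith, by linarith⟩
    have me : e ∈ Ioo (c - ε₀) (c + ε₀) := ⟨by linarith, by linarith⟩
    have md : d ∈ Ioo (c - ε₀) (c + ε₀) := ⟨by linarith, by linarith⟩
    have wmono : ∀ x ∈ Ioo (c - ε₀) (c + ε₀), ∀ y ∈ Ioo (c - ε₀) (c + ε₀), x ≤ y →
        φ x ≤ φ y := by
      intro x hx y hy hxy
      have h1 := (hlip x (hball hx).1 y (hball hy).1 hxy).1
      have h2 := mul_nonneg hm.le (sub_nonneg.2 hxy)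
      linarith
    have i := oddPow_slope hp (wmono a ma b mb hab) (wmono b mb e me hbe) (wmono e me d md hed)
    rw [← hconj a (hsub (hball ma).1), ← hconj b (hsub (hball mb).1),
      ← hconj e (hsub (hball me).1), ← hconj d (hsub (hball md).1)] at i
    have j1 := (hlip' _ (hball mb).2.1 _ (hball me).2.1 (hmono.monotone hbe)).1
    have j2 := (hlip a (hball ma).1 d (hball md).1 had).1
    have j3 := (hlip' _ (hball ma).2.1 _ (hball md).2.1 (hmono.monotone had)).2
    have j4 := (hlip b (hball mb).1 e (hball me).1 hbe).2
    have k1 : 0 ≤ H.lift e - H.lift b := sub_nonneg.2 (hmono.monotone hbe)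
    have k2 : 0 ≤ H.lift d - H.lift a := sub_nonneg.2 (hmono.monotone had)
    have l1 : 0 ≤ d - a := by linarith
    have l2 : 0 ≤ e - b := by linarith
    have hp0 : 0 < p := by linarith
    have lhs : (m' * (H.lift e - H.lift b)) * (m * (d - a)) ≤
        2 * p * ((M' * (H.lift d - H.lift a)) * (M * (e - b))) := by
      refine (mul_le_mul j1 j2 (by positivity) ((mul_nonneg hm'.le k1).trans j1)).trans
        (i.trans ?_)
      refine mul_le_mul_of_nonneg_left ?_ (by positivity)
      exact mul_le_mul j3 j4 (sub_nonneg.2 (wmono b mb e me hbe)) (by positivity)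
    rw [div_mul_eq_mul_div, le_div_iff₀ (by positivity)]
    linarith
  have hp0 : 0 < p := by linarith
  have hS0 : 0 ≤ 2 * p * M' * M / (m' * m) := by positivity
  have hQ0 : 0 ≤ C + C' * L ^ 2 := by positivity
  have hexp : ∀ r : ℝ, Real.exp (-((2 * p * M' * M / (m' * m) + (C + C' * L ^ 2)) * r ^ 2)) ≤
      Real.exp (-((C + C' * L ^ 2) * r ^ 2)) := by
    intro r
    refine Real.exp_le_exp.2 (neg_le_neg (mul_le_mul_of_nonneg_right ?_ (sq_nonneg r)))
    linarith
  refine ⟨2 * p * M' * M / (m' * m) + (C + C' * L ^ 2), by positivity, ε₀, hε₀, ?_, ?_, ?_⟩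
  · intro a d h1 h2 h3
    exact (slope a d h1 h2 h3).mono hmono.monotone (by linarith)
  · intro a b e d ha hab hbe hed hd hcr
    have ma : a ∈ Ioo (c - ε₀) (c + ε₀) := ⟨ha, by linarith⟩
    have mb : b ∈ Ioo (c - ε₀) (c + ε₀) := ⟨by linarith, by linarith⟩
    have mc : c ∈ Ioo (c - ε₀) (c + ε₀) := ⟨by linarith, by linarith⟩
    have me : e ∈ Ioo (c - ε₀) (c + ε₀) := ⟨by linarith, by linarith⟩
    have md : d ∈ Ioo (c - ε₀) (c + ε₀) := ⟨by linarith, by linarith⟩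
    have := chain 1 zero_le_one a b e d ha hab hbe hed hd (by
      rw [one_mul]
      refine crossRatio_oddPow hp (hφmono a ma b mb hab) (hφmono b mb e me hbe)
        (hφmono e me d md hed) ?_
      rintro ⟨h1, h2⟩
      refine hcr ⟨?_, ?_⟩
      · by_contra hle
        rcases (not_lt.1 hle).eq_or_lt with h | h
        · rw [← h, hφc] at h1; exact lt_irrefl _ h1
        · have := hφmono c mc a ma h
          linarith
      · by_contra hle
        rcases (not_lt.1 hle).eq_or_lt with h | h
        · rw [h, hφc] at h2; exact lt_irrefl _ h2
        · have := hφmono d md c mc h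
          linarith)
    rw [one_mul] at this
    exact (mul_le_mul_of_nonneg_right (hexp _) (crossRatio_pos hab hbe hed).le).trans this
  · intro K hK
    have hbase : 1 < 1 + m / (M * K) := by
      have : 0 < m / (M * K) := by positivity
      linarith
    have hgt := Real.one_lt_rpow hbase (show 0 < (p - 1) / 2 by linarith)
    refine ⟨(1 + m / (M * K)) ^ ((p - 1) / 2) - 1, by linarith, ?_⟩
    intro b e d hcb hbe hed hd hKb
    have mb : b ∈ Ioo (c - ε₀) (c + ε₀) := ⟨by linarith, by linarith⟩
    have mc : c ∈ Ioo (c - ε₀) (c + ε₀) := ⟨by linarith, by linarith⟩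
    have me : e ∈ Ioo (c - ε₀) (c + ε₀) := ⟨by linarith, by linarith⟩
    have md : d ∈ Ioo (c - ε₀) (c + ε₀) := ⟨by linarith, by linarith⟩
    have hφb := hφmono c mc b mb hcb
    have hbe' := hφmono b mb e me hbe
    have hed' := hφmono e me d md hed
    rw [hφc] at hφb
    have hratio : 1 + m / (M * K) ≤ φ e / φ b := by
      have j1 := (hlip b (hball mb).1 e (hball me).1 hbe.le).1
      have j2 := (hlip c (hball mc).1 b (hball mb).1 hcb.le).2
      rw [hφc, sub_zero] at j2
      have j3 : φ b ≤ M * (K * (e - b)) := j2.trans (mul_le_mul_of_nonneg_left hKb hM.le)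
      rw [le_div_iff₀ hφb, add_mul, one_mul]
      have : m / (M * K) * φ b ≤ m / (M * K) * (M * (K * (e - b))) := by gcongr
      have e2 : m / (M * K) * (M * (K * (e - b))) = m * (e - b) := by field_simp
      linarith
    rw [add_sub_cancel]
    have h0 : 0 ≤ (1 + m / (M * K)) ^ ((p - 1) / 2) := by linarith
    have := chain _ h0 c b e d mc.1 hcb hbe hed hd (by
      rw [hφc]
      refine le_trans ?_ (crossRatio_oddPow_zero hp hφb hbe' hed')
      refine mul_le_mul_of_nonneg_right ?_ (crossRatio_pos hφb hbe' hed').le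
      exact Real.rpow_le_rpow (by linarith) hratio (by linarith))
    refine le_trans ?_ this
    have := (crossRatio_pos hcb hbe hed).le
    exact mul_le_mul_of_nonneg_right (mul_le_mul_of_nonneg_left (hexp _) h0) this

lemma CircleHomeo.exists_local_bounds {H : CircleHomeo} (hH : ContDiff ℝ 3 H.lift) {x : ℝ}
    (hx : deriv H.lift x ≠ 0) :
    ∃ C ≥ 0, ∃ ε > 0,
      (∀ a d, x - ε < a → a ≤ d → d < x + ε → SlopeBound H.lift C a d) ∧
      (∀ a b e d, x - ε < a → a < b → b < e → e < d → d < x + ε →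
        Real.exp (-(C * (d - a) ^ 2)) * crossRatio a b e d ≤
          crossRatio (H.lift a) (H.lift b) (H.lift e) (H.lift d)) := by
  have hpos : 0 < deriv H.lift x :=
    lt_of_le_of_ne (H.lift_strictMono.monotone.deriv_nonneg) hx.symm
  obtain ⟨m, M, C, hm, hM, hC, ε, hε, -, hlip, hdist⟩ :=
    exists_crossRatio_distortion isOpen_univ (mem_univ x) hH.contDiffOn hpos
  have hMm : 0 ≤ M / m := by positivity
  refine ⟨M / m + C, by positivity, ε, hε, ?_, ?_⟩
  · intro a d ha had hd
    refine SlopeBound.mono H.lift_strictMono.monotone (n := M / m) (by linarith) ?_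
    intro b e hab hbe hed
    have j1 := (hlip b ⟨by linarith, by linarith⟩ e ⟨by linarith, by linarith⟩ hbe).2
    have j2 := (hlip a ⟨by linarith, by linarith⟩ d ⟨by linarith, by linarith⟩ had).1
    have k1 : 0 ≤ d - a := by linarith
    have k2 : 0 ≤ e - b := by linarith
    calc _ ≤ M * (e - b) * (d - a) := by gcongr
      _ = M / m * ((m * (d - a)) * (e - b)) := by field_simp
      _ ≤ _ := by gcongr
  · intro a b e d ha hab hbe hed hd
    refine le_trans ?_ (hdist a ⟨by linarith, by linarith⟩ d ⟨by linarith, by linarith⟩ b e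
      hab hbe hed).1
    refine mul_le_mul_of_nonneg_right ?_ (crossRatio_pos hab hbe hed).le
    refine Real.exp_le_exp.2 (neg_le_neg (mul_le_mul_of_nonneg_right ?_ (sq_nonneg _)))
    linarith

namespace MulticriticalCircleMap

variable (f : MulticriticalCircleMap)

lemma crossRatio_lift_add_int (k : ℤ) (a b c d : ℝ) :
    crossRatio (f.lift (a + k)) (f.lift (b + k)) (f.lift (c + k)) (f.lift (d + k)) =
      crossRatio (f.lift a) (f.lift b) (f.lift c) (f.lift d) := by
  simp only [add_int_of_add_one f.lift_add_one, crossRatio_add]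

lemma add_int_mem_critLift {z : ℝ} (k : ℤ) (hz : z ∈ f.critLift) : z + k ∈ f.critLift := by
  obtain ⟨i, l, rfl⟩ := hz
  exact ⟨i, l + k, by push_cast; ring⟩

lemma exists_bounds_of_mem_critLift : ∃ C ≥ 0, ∃ ε > 0, ∀ c ∈ f.critLift,
      (∀ a d, c - ε < a → a ≤ d → d < c + ε → SlopeBound f.lift C a d) ∧
      (∀ a b e d, c - ε < a → a < b → b < e → e < d → d < c + ε → ¬ (a < c ∧ c < d) →
        Real.exp (-(C * (d - a) ^ 2)) * crossRatio a b e d ≤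
          crossRatio (f.lift a) (f.lift b) (f.lift e) (f.lift d)) := by
  have h1 : ContDiff ℝ 1 f.lift := f.smooth.of_le (by norm_num)
  choose C hC ε hε hS hX _ using
    fun i => (f.crit_powerLaw i).exists_local_bounds h1 (f.critExp_gt_one i)
  have : Nonempty (Fin f.N) := ⟨⟨0, f.N_pos⟩⟩
  obtain ⟨i₁, hi₁⟩ := Finite.exists_max C
  obtain ⟨i₂, hi₂⟩ := Finite.exists_min ε
  refine ⟨C i₁, hC i₁, ε i₂, hε i₂, ?_⟩
  rintro _ ⟨i, k, rfl⟩
  have l2 := hi₂ i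
  constructor
  · intro a d ha had hd
    have := (hS i (a - k) (d - k) (by linarith) (by linarith) (by linarith)).add_int
      f.lift_add_one k
    rw [sub_add_cancel, sub_add_cancel] at this
    exact this.mono f.lift_strictMono.monotone (hi₁ i)
  · intro a b e d ha hab hbe hed hd hcr
    have := hX i (a - k) (b - k) (e - k) (d - k) (by linarith) (by linarith) (by linarith)
      (by linarith) (by linarith) (fun h => hcr ⟨by linarith [h.1], by linarith [h.2]⟩)
    rw [← f.crossRatio_lift_add_int k, ← crossRatio_add _ _ _ _ (k : ℝ)] at this
    simp only [sub_add_cancel, sub_sub_sub_cancel_right] at this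
    refine le_trans ?_ this
    refine mul_le_mul_of_nonneg_right ?_ (crossRatio_pos hab hbe hed).le
    exact Real.exp_le_exp.2 (neg_le_neg (mul_le_mul_of_nonneg_right (hi₁ i) (sq_nonneg _)))

/-- Cross-ratios whose left endpoint is critical are expanded by a definite factor. -/
lemma exists_crossRatio_expansion : ∃ C ≥ 0, ∃ ε > 0, ∀ K > 0, ∃ η > 0, ∀ c ∈ f.critLift,
    ∀ b e d, c < b → b < e → e < d → d < c + ε → b - c ≤ K * (e - b) →
      (1 + η) * Real.exp (-(C * (d - c) ^ 2)) * crossRatio c b e d ≤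
        crossRatio (f.lift c) (f.lift b) (f.lift e) (f.lift d) := by
  have h1 : ContDiff ℝ 1 f.lift := f.smooth.of_le (by norm_num)
  choose C hC ε hε _ _ hX using
    fun i => (f.crit_powerLaw i).exists_local_bounds h1 (f.critExp_gt_one i)
  have : Nonempty (Fin f.N) := ⟨⟨0, f.N_pos⟩⟩
  obtain ⟨i₁, hi₁⟩ := Finite.exists_max C
  obtain ⟨i₂, hi₂⟩ := Finite.exists_min ε
  refine ⟨C i₁, hC i₁, ε i₂, hε i₂, fun K hK => ?_⟩
  choose η hη hX using fun i => hX i K hK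
  obtain ⟨i₃, hi₃⟩ := Finite.exists_min η
  refine ⟨η i₃, hη i₃, ?_⟩
  rintro _ ⟨i, k, rfl⟩ b e d hcb hbe hed hd hKb
  have l2 := hi₂ i
  have := hX i (b - k) (e - k) (d - k) (by linarith) (by linarith) (by linarith)
    (by linarith) (by linarith)
  rw [← f.crossRatio_lift_add_int k, ← crossRatio_add _ _ _ _ (k : ℝ)] at this
  simp only [sub_add_cancel] at this
  refine le_trans ?_ this
  refine mul_le_mul_of_nonneg_right ?_ (crossRatio_pos hcb hbe hed).le
  refine mul_le_mul (by linarith [hi₃ i]) ?_ (Real.exp_pos _).le (by linarith [hη i])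
  rw [show d - k - f.crit i = d - (f.crit i + k) by ring]
  exact Real.exp_le_exp.2 (neg_le_neg (mul_le_mul_of_nonneg_right (hi₁ i) (sq_nonneg _)))

lemma exists_local_bounds : ∃ C ≥ 0, ∃ ε > 0, ∀ a d, a ≤ d → d - a < ε →
    SlopeBound f.lift C a d ∧ ∀ b c, a < b → b < c → c < d →
      (∀ z ∈ f.critLift, ¬ (a < z ∧ z < d)) →
        Real.exp (-(C * (d - a) ^ 2)) * crossRatio a b c d ≤
          crossRatio (f.lift a) (f.lift b) (f.lift c) (f.lift d) := by
  obtain ⟨C₀, hC₀, ε₀, hε₀, hcrit⟩ := f.exists_bounds_of_mem_critLift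
  have key : ∃ n : ℕ, ∃ ε > 0, ∀ a d, a ≤ d → d - a < ε →
      SlopeBound f.lift n a d ∧ ∀ b c, a < b → b < c → c < d →
        (∀ z ∈ f.critLift, ¬ (a < z ∧ z < d)) →
        Real.exp (-(n * (d - a) ^ 2)) * crossRatio a b c d ≤
          crossRatio (f.lift a) (f.lift b) (f.lift c) (f.lift d) := by
    refine exists_uniform_of_local (R := fun n a d => SlopeBound f.lift n a d ∧
      ∀ b c, a < b → b < c → c < d → (∀ z ∈ f.critLift, ¬ (a < z ∧ z < d)) →
        Real.exp (-(n * (d - a) ^ 2)) * crossRatio a b c d ≤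
          crossRatio (f.lift a) (f.lift b) (f.lift c) (f.lift d)) ?_ ?_ ?_
    · rintro n m a d hnm had ⟨hS, hX⟩
      have hnm' : (n : ℝ) ≤ m := by exact_mod_cast hnm
      refine ⟨hS.mono f.lift_strictMono.monotone hnm', fun b c h1 h2 h3 hz => ?_⟩
      refine le_trans ?_ (hX b c h1 h2 h3 hz)
      refine mul_le_mul_of_nonneg_right ?_ (crossRatio_pos h1 h2 h3).le
      exact Real.exp_le_exp.2 (neg_le_neg (mul_le_mul_of_nonneg_right hnm' (sq_nonneg _)))
    · rintro n a d k ⟨hS, hX⟩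
      refine ⟨hS.add_int f.lift_add_one k, fun b c h1 h2 h3 hz => ?_⟩
      have := hX (b - k) (c - k) (by linarith) (by linarith) (by linarith) (by
        rintro z hz' ⟨h4, h5⟩
        exact hz _ (f.add_int_mem_critLift k hz') ⟨by linarith, by linarith⟩)
      rw [← f.crossRatio_lift_add_int k, ← crossRatio_add _ _ _ _ (k : ℝ)] at this
      simpa only [sub_add_cancel, add_sub_add_right_eq_sub] using this
    · intro x
      by_cases hx : deriv f.lift x = 0
      · obtain ⟨i, k, hxc⟩ := f.crit_complete x hx
        obtain ⟨hS, hX⟩ := hcrit x ⟨i, k, hxc⟩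
        obtain ⟨n, hn⟩ := exists_nat_ge C₀
        refine ⟨n, ε₀, hε₀, fun a d ha had hd => ⟨(hS a d ha had hd).mono
          f.lift_strictMono.monotone hn, fun b c h1 h2 h3 hz => ?_⟩⟩
        refine le_trans ?_ (hX a b c d ha h1 h2 h3 hd (hz x ⟨i, k, hxc⟩))
        refine mul_le_mul_of_nonneg_right ?_ (crossRatio_pos h1 h2 h3).le
        exact Real.exp_le_exp.2 (neg_le_neg (mul_le_mul_of_nonneg_right hn (sq_nonneg _)))
      · obtain ⟨C, hC, ε, hε, hS, hX⟩ := f.toCircleHomeo.exists_local_bounds f.smooth hx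
        obtain ⟨n, hn⟩ := exists_nat_ge C
        refine ⟨n, ε, hε, fun a d ha had hd => ⟨(hS a d ha had hd).mono
          f.lift_strictMono.monotone hn, fun b c h1 h2 h3 hz => ?_⟩⟩
        refine le_trans ?_ (hX a b c d ha h1 h2 h3 hd)
        refine mul_le_mul_of_nonneg_right ?_ (crossRatio_pos h1 h2 h3).le
        exact Real.exp_le_exp.2 (neg_le_neg (mul_le_mul_of_nonneg_right hn (sq_nonneg _)))
  obtain ⟨n, ε, hε, h⟩ := key
  exact ⟨n, n.cast_nonneg, ε, hε, h⟩

lemma exists_slopeBound : ∃ C > 0, ∀ a d, a ≤ d → d ≤ a + 1 → SlopeBound f.lift C a d := by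
  obtain ⟨C, hC, ε, hε, h⟩ := f.exists_local_bounds
  obtain ⟨L, hL, hLip⟩ := f.toCircleHomeo.exists_lipschitz (f.smooth.of_le (by norm_num))
  obtain ⟨δ, hδ, hinc⟩ := exists_le_sub_of_strictMono f.lift_strictMono f.lift_continuous
    f.lift_add_one hε
  have hLδ : 0 < L / δ := by positivity
  refine ⟨C + L / δ, by positivity, fun a d had hd => ?_⟩
  rcases lt_or_ge (d - a) ε with h1 | h1
  · exact (h a d had h1).1.mono f.lift_strictMono.monotone (by linarith)
  · refine SlopeBound.mono f.lift_strictMono.monotone (n := L / δ) (by linarith) ?_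
    intro b c hab hbc hcd
    have j1 := hLip b c hbc (by linarith)
    have j2 : δ ≤ f.lift d - f.lift a :=
      (hinc a).trans (sub_le_sub_right (f.lift_strictMono.monotone (by linarith)) _)
    have k1 : 0 ≤ c - b := by linarith
    calc _ ≤ L * (c - b) * 1 :=
          mul_le_mul j1 (by linarith) (by linarith) (by positivity)
      _ = L / δ * (δ * (c - b)) := by field_simp
      _ ≤ _ := by gcongr

/-- Cross-ratio inequality: cross-ratios contract at most exponentially in the length of the
interval, up to a constant factor when the interval contains a critical point. -/
lemma exists_crossRatio_inequality : ∃ κ ≥ 0, ∃ C ≥ 0, ∀ a b c d, a < b → b < c → c < d →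
    d ≤ a + 1 →
      Real.exp (-κ) * crossRatio a b c d ≤
        crossRatio (f.lift a) (f.lift b) (f.lift c) (f.lift d) ∧
      ((∀ z ∈ f.critLift, ¬ (a < z ∧ z < d)) →
        Real.exp (-(C * (d - a))) * crossRatio a b c d ≤
          crossRatio (f.lift a) (f.lift b) (f.lift c) (f.lift d)) := by
  obtain ⟨C, hC, ε, hε, h⟩ := f.exists_local_bounds
  obtain ⟨n, hn, hS⟩ := f.exists_slopeBound
  have hm := f.lift_strictMono
  obtain ⟨κ, hκ, hκn⟩ : ∃ κ ≥ 0, Real.exp (-κ) ≤ n⁻¹ * n⁻¹ := by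
    refine ⟨|Real.log (n * n)|, abs_nonneg _, ?_⟩
    rw [Real.exp_neg, ← mul_inv]
    refine inv_anti₀ (by positivity) ?_
    calc n * n = Real.exp (Real.log (n * n)) := (Real.exp_log (by positivity)).symm
      _ ≤ _ := Real.exp_le_exp.2 (le_abs_self _)
  have crude : ∀ a b c d, a < b → b < c → c < d → d ≤ a + 1 →
      Real.exp (-κ) * crossRatio a b c d ≤
        crossRatio (f.lift a) (f.lift b) (f.lift c) (f.lift d) := by
    intro a b c d h1 h2 h3 h4
    refine (mul_le_mul_of_nonneg_right hκn (crossRatio_pos h1 h2 h3).le).trans ?_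
    refine crossRatio_mul_le h1 h2 h3 (hm h1) (hm h2) (hm h3) (by positivity) ?_ ?_
    · rw [inv_mul_le_iff₀ hn]
      exact hS a c (by linarith) (by linarith) a b le_rfl h1.le h2.le
    · rw [inv_mul_le_iff₀ hn]
      exact hS b d (by linarith) (by linarith) c d h2.le h3.le le_rfl
  refine ⟨κ, hκ, C + κ / ε, by positivity, fun a b c d h1 h2 h3 h4 => ⟨crude a b c d h1 h2 h3 h4,
    fun hz => ?_⟩⟩
  have hκε : 0 ≤ κ / ε := by positivity
  have hda : 0 ≤ d - a := by linarith
  have hCd : 0 ≤ C * (d - a) := by positivity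
  have hX := (crossRatio_pos h1 h2 h3).le
  rcases lt_or_ge (d - a) ε with h5 | h5
  · refine le_trans (mul_le_mul_of_nonneg_right (Real.exp_le_exp.2 ?_) hX)
      ((h a d (by linarith) h5).2 b c h1 h2 h3 hz)
    have : C * (d - a) ^ 2 ≤ C * (d - a) := by
      refine mul_le_mul_of_nonneg_left ?_ hC
      nlinarith
    nlinarith
  · refine le_trans (mul_le_mul_of_nonneg_right (Real.exp_le_exp.2 ?_) hX)
      (crude a b c d h1 h2 h3 h4)
    have : κ ≤ κ / ε * (d - a) := by
      rw [div_mul_eq_mul_div, le_div_iff₀ hε]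
      exact mul_le_mul_of_nonneg_left h5 hκ
    nlinarith

end MulticriticalCircleMap

lemma projC_surjective : Function.Surjective projC := QuotientAddGroup.mk_surjective

lemma projC_eq_iff {x y : ℝ} : projC x = projC y ↔ ∃ k : ℤ, x = y + k := by
  unfold projC
  rw [← sub_eq_zero, ← AddCircle.coe_sub, AddCircle.coe_eq_zero_iff]
  refine exists_congr fun k => ?_
  rw [zsmul_one]
  constructor <;> intro h <;> linarith

lemma continuous_projC : Continuous projC := AddCircle.continuous_mk' 1

lemma injOn_projC (a : ℝ) : InjOn projC (Ioc a (a + 1)) := by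
  intro x hx y hy hxy
  obtain ⟨k, rfl⟩ := projC_eq_iff.1 hxy
  have h1 : (k : ℝ) < 1 := by linarith [hx.2, hy.1]
  have h2 : (-1 : ℝ) < k := by linarith [hx.1, hy.2]
  have h3 : k = 0 := by
    have : k < 1 := by exact_mod_cast h1
    have : -1 < k := by exact_mod_cast h2
    omega
  simp [h3]

lemma measurableSet_projC_image {a : ℝ} {S : Set ℝ} (hS : MeasurableSet S)
    (hSa : S ⊆ Ioc a (a + 1)) : MeasurableSet (projC '' S) :=
  hS.image_of_continuousOn_injOn continuous_projC.continuousOn ((injOn_projC a).mono hSa)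

lemma setLIntegral_projC_image {a : ℝ} {S : Set ℝ} (hS : MeasurableSet S)
    (hSa : S ⊆ Ioc a (a + 1)) {r : Circle1 → ℝ≥0∞} (hr : Measurable r) :
    ∫⁻ z in projC '' S, r z = ∫⁻ x in S, r (projC x) := by
  have hmp : MeasurePreserving projC (volume.restrict (Ioc a (a + 1))) volume :=
    AddCircle.measurePreserving_mk 1 a
  rw [← hmp.setLIntegral_comp_preimage (measurableSet_projC_image hS hSa) hr,
    Measure.restrict_restrict (continuous_projC.measurable (measurableSet_projC_image hS hSa))]
  congr 2
  ext x
  constructor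
  · rintro ⟨⟨y, hy, hyx⟩, hx⟩
    rwa [← injOn_projC a (hSa hy) hx hyx]
  · exact fun hx => ⟨⟨x, hx, rfl⟩, hSa hx⟩

lemma volume_projC_image {a : ℝ} {S : Set ℝ} (hS : MeasurableSet S)
    (hSa : S ⊆ Ioc a (a + 1)) : volume (projC '' S) = volume S := by
  have := setLIntegral_projC_image hS hSa (r := fun _ => 1) measurable_const
  simpa using this

lemma volume_projC_image_eq_zero {S : Set ℝ} (hS : volume S = 0) : volume (projC '' S) = 0 := by
  have hsub : projC '' S ⊆ ⋃ k : ℤ, projC '' (toMeasurable volume S ∩ Ioc (k : ℝ) (k + 1)) := by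
    rintro _ ⟨x, hx, rfl⟩
    refine mem_iUnion.2 ⟨⌈x⌉ - 1, x, ⟨subset_toMeasurable _ _ hx, ?_, ?_⟩, rfl⟩
    · push_cast; linarith [Int.ceil_lt_add_one x]
    · push_cast; linarith [Int.le_ceil x]
  refine measure_mono_null hsub (measure_iUnion_null fun k => ?_)
  rw [volume_projC_image ((measurableSet_toMeasurable _ _).inter measurableSet_Ioc)
    inter_subset_right]
  exact measure_mono_null inter_subset_left (by rwa [measure_toMeasurable])

lemma volume_projC_preimage_eq_zero {A : Set Circle1} (hA : volume A = 0) :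
    volume (projC ⁻¹' A) = 0 := by
  have hsub : projC ⁻¹' A ⊆ ⋃ k : ℤ, projC ⁻¹' (toMeasurable volume A) ∩ Ioc (k : ℝ) (k + 1) := by
    intro x hx
    refine mem_iUnion.2 ⟨⌈x⌉ - 1, ⟨subset_toMeasurable _ _ hx, ?_, ?_⟩⟩
    · push_cast; linarith [Int.ceil_lt_add_one x]
    · push_cast; linarith [Int.le_ceil x]
  refine measure_mono_null hsub (measure_iUnion_null fun k => ?_)
  rw [← volume_projC_image (a := k) ((continuous_projC.measurable
    (measurableSet_toMeasurable _ _)).inter measurableSet_Ioc) inter_subset_right]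
  refine measure_mono_null ?_ ((measure_toMeasurable A).trans hA)
  rintro _ ⟨x, hx, rfl⟩
  exact hx.1

lemma volume_projC_preimage_eq_zero_iff {A : Set Circle1} :
    volume (projC ⁻¹' A) = 0 ↔ volume A = 0 := by
  refine ⟨fun h => ?_, volume_projC_preimage_eq_zero⟩
  rw [← image_preimage_eq A projC_surjective]
  exact volume_projC_image_eq_zero h

namespace CircleHomeo

variable (H : CircleHomeo)

lemma measurable_toFun : Measurable H.toFun := H.toHomeo.continuous.measurable

lemma toFun_projC (x : ℝ) : H.toFun (projC x) = projC (H.lift x) := H.lift_proj x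

lemma projC_preimage_preimage (A : Set Circle1) :
    projC ⁻¹' (H.toFun ⁻¹' A) = H.lift ⁻¹' (projC ⁻¹' A) := by
  ext x
  simp [H.toFun_projC]

lemma projC_preimage_image (A : Set Circle1) :
    projC ⁻¹' (H.toFun '' A) ⊆ H.lift '' (projC ⁻¹' A) := by
  rintro x ⟨z, hz, hzx⟩
  obtain ⟨y, rfl⟩ := projC_surjective z
  rw [H.toFun_projC] at hzx
  obtain ⟨k, hk⟩ := projC_eq_iff.1 hzx.symm
  refine ⟨y + k, ?_, by rw [add_int_of_add_one H.lift_add_one, hk]⟩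
  change projC (y + k) ∈ A
  rwa [projC_eq_iff.2 ⟨k, rfl⟩]

lemma volume_image_eq_zero (hH : Differentiable ℝ H.lift) {A : Set Circle1} (hA : volume A = 0) :
    volume (H.toFun '' A) = 0 := by
  rw [← volume_projC_preimage_eq_zero_iff] at hA ⊢
  exact measure_mono_null (H.projC_preimage_image A)
    (addHaar_image_eq_zero_of_differentiableOn_of_addHaar_eq_zero volume hH.differentiableOn hA)

end CircleHomeo

lemma MulticriticalCircleMap.volume_preimage_eq_zero (f : MulticriticalCircleMap)
    {A : Set Circle1} (hA : volume A = 0) : volume (f.toFun ⁻¹' A) = 0 := by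
  suffices h : ∀ A : Set Circle1, MeasurableSet A → volume A = 0 → volume (f.toFun ⁻¹' A) = 0 from
    measure_mono_null (preimage_mono (subset_toMeasurable volume A))
      (h _ (measurableSet_toMeasurable _ _) ((measure_toMeasurable A).trans hA))
  intro A hAm hA
  rw [← volume_projC_preimage_eq_zero_iff] at hA ⊢
  rw [f.projC_preimage_preimage]
  set P := f.lift ⁻¹' (projC ⁻¹' A) with hP
  have hPm : MeasurableSet P := f.lift_continuous.measurable (continuous_projC.measurable hAm)
  have hdiff : Differentiable ℝ f.lift := f.smooth.differentiable (by norm_num)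
  have himg : volume (f.lift '' P) = 0 := measure_mono_null (image_preimage_subset _ _) hA
  have hint := lintegral_image_eq_lintegral_abs_deriv_mul (f := f.lift) (f' := deriv f.lift) hPm
    (fun x _ => (hdiff x).hasDerivAt.hasDerivWithinAt) f.lift_strictMono.injective.injOn
    (fun _ => 1)
  simp only [mul_one, lintegral_const, Measure.restrict_apply_univ, himg, mul_zero] at hint
  have hcrit : f.critLift.Countable := by
    refine (countable_range (fun q : Fin f.N × ℤ => f.crit q.1 + q.2)).mono ?_
    rintro x ⟨i, k, rfl⟩
    exact ⟨(i, k), rfl⟩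
  have hae := (lintegral_eq_zero_iff
    ((measurable_deriv f.lift).abs.ennreal_ofReal)).1 hint.symm
  rw [Filter.EventuallyEq, ae_restrict_iff' hPm] at hae
  refine measure_mono_null (t := {x | ¬ (x ∈ P → ENNReal.ofReal |deriv f.lift x| = 0)} ∪ f.critLift)
    ?_ (measure_union_null hae (hcrit.measure_zero _))
  intro x hx
  by_cases hd : deriv f.lift x = 0
  · exact Or.inr (f.crit_complete x hd)
  · left
    intro h
    have := h hx
    rw [ENNReal.ofReal_eq_zero] at this
    exact hd (abs_eq_zero.1 (le_antisymm this (abs_nonneg _)))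

/-- The unique invariant measure is either singular or absolutely continuous. -/
lemma MulticriticalCircleMap.absolutelyContinuous_of_not_singular (f : MulticriticalCircleMap)
    {μ : Measure Circle1} (hμ : IsInvProbMeasure f.toCircleHomeo μ)
    (huniq : ∀ ν : Measure Circle1, IsInvProbMeasure f.toCircleHomeo ν → ν = μ)
    (hs : ¬ ∃ X : Set Circle1, MeasurableSet X ∧ volume X = 0 ∧ μ X = 1) :
    μ ≪ volume := by
  obtain ⟨hprob, hinv⟩ := hμ
  have hT := f.measurable_toFun
  set s := μ.singularPart volume with hsdef
  set ac := (volume : Measure Circle1).withDensity (μ.rnDeriv volume) with hacdef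
  have hdec : μ = s + ac := μ.haveLebesgueDecomposition_add volume
  have hsing : s ⟂ₘ volume := μ.mutuallySingular_singularPart volume
  have hacac : ac ≪ volume := withDensity_absolutelyContinuous _ _
  have hsmap : s.map f.toFun ⟂ₘ volume := by
    obtain ⟨A, hA, hA0, hA1⟩ := hsing
    have hTA : MeasurableSet (f.toFun '' Aᶜ) :=
      f.toHomeo.measurableEmbedding.measurableSet_image.2 hA.compl
    refine ⟨(f.toFun '' Aᶜ)ᶜ, hTA.compl, ?_, ?_⟩
    · have hinj : Function.Injective f.toFun := f.toHomeo.injective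
      rw [Measure.map_apply hT hTA.compl, preimage_compl, preimage_image_eq _ hinj, compl_compl,
        hA0]
    · rw [compl_compl]
      exact f.volume_image_eq_zero (f.smooth.differentiable (by norm_num)) hA1
  have hacmap : ac.map f.toFun ≪ volume := by
    refine Measure.AbsolutelyContinuous.mk fun A hA hA0 => ?_
    rw [Measure.map_apply hT hA]
    exact hacac (f.volume_preimage_eq_zero hA0)
  have hdec' : μ = s.map f.toFun + ac.map f.toFun := by
    rw [← Measure.map_add _ _ hT, ← hdec]
    exact hinv.symm
  have hfin : IsFiniteMeasure ac := by
    rw [hacdef]; infer_instance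
  have hacwd : ac.map f.toFun =
      volume.withDensity ((ac.map f.toFun).rnDeriv volume) :=
    (Measure.withDensity_rnDeriv_eq _ _ hacmap).symm
  have hac : ac.map f.toFun = ac := by
    rw [hacwd] at hdec'
    have := Measure.eq_withDensity_rnDeriv (Measure.measurable_rnDeriv _ _) hsmap hdec'
    rw [hacwd, this]
  have hne : ac univ ≠ 0 := by
    intro h0
    have hac0 : ac = 0 := Measure.measure_univ_eq_zero.1 h0
    rw [hac0, add_zero] at hdec
    obtain ⟨A, hA, hA0, hA1⟩ := hsing
    refine hs ⟨Aᶜ, hA.compl, hA1, ?_⟩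
    rw [← hdec] at hA0
    rwa [prob_compl_eq_one_iff hA]
  have hν : IsInvProbMeasure f.toCircleHomeo ((ac univ)⁻¹ • ac) := by
    refine ⟨⟨?_⟩, ?_⟩
    · rw [Measure.smul_apply, smul_eq_mul, ENNReal.inv_mul_cancel hne (measure_ne_top _ _)]
    · rw [Measure.map_smul, hac]
  rw [← huniq _ hν]
  exact hacac.smul_left _

/-- The distribution function of an absolutely continuous probability measure on the circle,
lifted to the line. -/
lemma exists_distribution {μ : Measure Circle1} [IsProbabilityMeasure μ] (hac : μ ≪ volume) :
    ∃ H : ℝ → ℝ, Continuous H ∧ Monotone H ∧ (∀ x, H (x + 1) = H x + 1) ∧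
      (∀ a b, a ≤ b → b ≤ a + 1 → H b - H a = (μ (projC '' Ioc a b)).toReal) ∧
      ∀ᵐ x : ℝ, HasDerivAt H (μ.rnDeriv volume (projC x)).toReal x := by
  set r := μ.rnDeriv volume with hr
  have hrm : Measurable r := Measure.measurable_rnDeriv _ _
  have hμ : volume.withDensity r = μ := Measure.withDensity_rnDeriv_eq _ _ hac
  set g : ℝ → ℝ := fun x => (r (projC x)).toReal with hg
  have hrpm : Measurable fun x => r (projC x) := hrm.comp continuous_projC.measurable
  have hlint : ∀ a b : ℝ, b ≤ a + 1 →
      ∫⁻ x in Ioc a b, r (projC x) = μ (projC '' Ioc a b) := by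
    intro a b hb
    have hsub : Ioc a b ⊆ Ioc a (a + 1) := Ioc_subset_Ioc_right hb
    rw [← setLIntegral_projC_image measurableSet_Ioc hsub hrm, ← hμ,
      withDensity_apply _ (measurableSet_projC_image measurableSet_Ioc hsub)]
  have hint : ∀ a b : ℝ, b ≤ a + 1 → IntegrableOn g (Ioc a b) := by
    intro a b hb
    refine integrable_toReal_of_lintegral_ne_top hrpm.aemeasurable ?_
    rw [hlint a b hb]
    exact measure_ne_top _ _
  have hloc : LocallyIntegrable g := by
    intro x
    refine ⟨Ioc (x - 1 / 2) (x + 1 / 2), ?_, hint _ _ (by linarith)⟩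
    exact Filter.mem_of_superset (Ioo_mem_nhds (by linarith) (by linarith)) Ioo_subset_Ioc_self
  have hII : ∀ a b : ℝ, IntervalIntegrable g volume a b := fun a b =>
    (hloc.integrableOn_isCompact isCompact_uIcc).intervalIntegrable
  have hsub : ∀ a b : ℝ, (∫ t in (0 : ℝ)..b, g t) - ∫ t in (0 : ℝ)..a, g t = ∫ t in a..b, g t :=
    fun a b => intervalIntegral.integral_interval_sub_left (hII _ _) (hII _ _)
  have hmeas : ∀ a b, a ≤ b → b ≤ a + 1 →
      (∫ t in (0 : ℝ)..b, g t) - ∫ t in (0 : ℝ)..a, g t = (μ (projC '' Ioc a b)).toReal := by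
    intro a b hab hb
    rw [hsub, intervalIntegral.integral_of_le hab, ← hlint a b hb]
    refine integral_toReal hrpm.aemeasurable ?_
    refine ae_lt_top hrpm ?_
    rw [hlint a b hb]
    exact measure_ne_top _ _
  refine ⟨fun x => ∫ t in (0 : ℝ)..x, g t, intervalIntegral.continuous_primitive hII 0, ?_, ?_,
    hmeas, ?_⟩
  · intro a b hab
    have h1 := hsub a b
    have h2 : 0 ≤ ∫ t in a..b, g t :=
      intervalIntegral.integral_nonneg hab fun _ _ => ENNReal.toReal_nonneg
    simp only
    linarith
  · intro x
    have h1 := hmeas x (x + 1) (by linarith) le_rfl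
    have h2 : projC '' Ioc x (x + 1) = univ := by
      refine eq_univ_of_forall fun z => ?_
      obtain ⟨y, rfl⟩ := projC_surjective z
      refine ⟨y - (⌈y - x⌉ - 1 : ℤ), ⟨?_, ?_⟩, projC_eq_iff.2 ⟨-(⌈y - x⌉ - 1), ?_⟩⟩
      · push_cast; linarith [Int.ceil_lt_add_one (y - x)]
      · push_cast; linarith [Int.le_ceil (y - x)]
      · push_cast; ring
    rw [h2, measure_univ, ENNReal.toReal_one] at h1
    simp only
    linarith
  · filter_upwards [LocallyIntegrable.ae_hasDerivAt_integral hloc] with x hx using hx 0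

/-- The distribution function of an invariant measure conjugates the lift to the translation
by its translation number. -/
lemma CircleHomeo.distribution_lift_eq (G : CircleHomeo) {μ : Measure Circle1}
    (hinv : μ.map G.toFun = μ) {H : ℝ → ℝ} (hm : Monotone H) (h1 : ∀ x, H (x + 1) = H x + 1)
    (hH : ∀ a b, a ≤ b → b ≤ a + 1 → H b - H a = (μ (projC '' Ioc a b)).toReal) {β : ℝ}
    (hβ : ∀ x : ℝ, Tendsto (fun n : ℕ => G.lift^[n] x / n) atTop (nhds β)) (x : ℝ) :
    H (G.lift x) = H x + β := by
  have hinj : Function.Injective G.toFun := G.toHomeo.injective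
  have himg : ∀ a b, a ≤ b →
      G.toFun '' (projC '' Ioc a b) = projC '' Ioc (G.lift a) (G.lift b) := by
    intro a b hab
    have hsurj : G.lift '' Ioc a b = Ioc (G.lift a) (G.lift b) := by
      apply Subset.antisymm
      · rintro _ ⟨y, hy, rfl⟩
        exact ⟨G.lift_strictMono hy.1, G.lift_strictMono.monotone hy.2⟩
      · exact intermediate_value_Ioc hab G.lift_continuous.continuousOn
    rw [← hsurj, image_image, image_image]
    exact image_congr fun y _ => G.toFun_projC y
  have hmeas : ∀ B, MeasurableSet B → μ (G.toFun '' B) = μ B := by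
    intro B hB
    have hB' : MeasurableSet (G.toFun '' B) :=
      G.toHomeo.measurableEmbedding.measurableSet_image.2 hB
    conv_lhs => rw [← hinv]
    rw [Measure.map_apply G.measurable_toFun hB', preimage_image_eq _ hinj]
  have hstep : ∀ a b, a ≤ b → b ≤ a + 1 → H (G.lift b) - H (G.lift a) = H b - H a := by
    intro a b hab hb
    have hb' : G.lift b ≤ G.lift a + 1 := by
      rw [← G.lift_add_one]; exact G.lift_strictMono.monotone hb
    rw [hH _ _ (G.lift_strictMono.monotone hab) hb', hH _ _ hab hb, ← himg a b hab,
      hmeas _ (measurableSet_projC_image measurableSet_Ioc (Ioc_subset_Ioc_right hb))]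
  set c := H (G.lift 0) - H 0 with hc
  have hHk : ∀ (y : ℝ) (k : ℤ), H (y + k) = H y + k := add_int_of_add_one h1
  have hconst : ∀ y, H (G.lift y) = H y + c := by
    intro y
    have hy := hstep 0 (Int.fract y) (Int.fract_nonneg y) (by linarith [Int.fract_lt_one y])
    have e : y = Int.fract y + (⌊y⌋ : ℤ) := (Int.fract_add_floor y).symm
    rw [e, add_int_of_add_one G.lift_add_one, hHk, hHk]
    linarith
  have hiter : ∀ n : ℕ, H (G.lift^[n] 0) = H 0 + n * c := by
    intro n
    induction n with
    | zero => simp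
    | succ n ih =>
      rw [Function.iterate_succ_apply', hconst, ih]
      push_cast; ring
  have hbdd : ∀ y, |H y - H 0 - y| ≤ 1 := by
    intro y
    have e : y = Int.fract y + (⌊y⌋ : ℤ) := (Int.fract_add_floor y).symm
    have hy0 := hm (Int.fract_nonneg y)
    have hy1 := hm (Int.fract_lt_one y).le
    have h01 := h1 0
    rw [zero_add] at h01
    have hHy : H y = H (Int.fract y) + (⌊y⌋ : ℤ) := by
      conv_lhs => rw [e]
      exact hHk _ _
    rw [hHy, abs_le]
    constructor <;> linarith [Int.fract_nonneg y, Int.fract_lt_one y]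
  have hlim : Tendsto (fun n : ℕ => G.lift^[n] 0 / n) atTop (nhds c) := by
    have h0 : Tendsto (fun n : ℕ => (1 : ℝ) / n) atTop (nhds 0) :=
      tendsto_const_div_atTop_nhds_zero_nat 1
    have h2 : Tendsto (fun n : ℕ => G.lift^[n] 0 / n - c) atTop (nhds 0) := by
      refine squeeze_zero_norm' ?_ h0
      filter_upwards [eventually_gt_atTop 0] with n hn
      have hn' : (0 : ℝ) < n := by exact_mod_cast hn
      have hb := hbdd (G.lift^[n] 0)
      rw [hiter] at hb
      rw [Real.norm_eq_abs, div_sub' hn'.ne', abs_div, abs_of_pos hn']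
      refine div_le_div_of_nonneg_right ?_ hn'.le
      rw [abs_le] at hb ⊢
      constructor <;> linarith
    simpa using h2.add_const c
  have hcβ : c = β := tendsto_nhds_unique hlim (hβ 0)
  rw [hconst, hcβ]

/-- At scale `δ` around `x`, the function `H` is affine up to a relative error `ε`, with a slope
between `δ` and `δ⁻¹`. -/
def AlmostAffineAt (H : ℝ → ℝ) (ε δ x : ℝ) : Prop :=
  ∃ ρ ∈ Icc δ δ⁻¹, ∀ t ∈ Icc (-δ) δ, |H (x + t) - H x - ρ * t| ≤ ε * ρ * |t|

lemma AlmostAffineAt.mono {H : ℝ → ℝ} {ε δ δ' x : ℝ} (h : AlmostAffineAt H ε δ x) (hδ' : 0 < δ')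
    (hδ : δ' ≤ δ) : AlmostAffineAt H ε δ' x := by
  obtain ⟨ρ, hρ, h⟩ := h
  exact ⟨ρ, ⟨hδ.trans hρ.1, hρ.2.trans (inv_anti₀ hδ' hδ)⟩,
    fun t ht => h t ⟨by linarith [ht.1], by linarith [ht.2]⟩⟩

lemma AlmostAffineAt.add_int {H : ℝ → ℝ} {ε δ x : ℝ} (h1 : ∀ x, H (x + 1) = H x + 1)
    (h : AlmostAffineAt H ε δ x) (k : ℤ) : AlmostAffineAt H ε δ (x + k) := by
  obtain ⟨ρ, hρ, h⟩ := h
  refine ⟨ρ, hρ, fun t ht => ?_⟩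
  rw [add_right_comm, add_int_of_add_one h1, add_int_of_add_one h1]
  convert h t ht using 2
  ring

lemma isClosed_almostAffineAt {H : ℝ → ℝ} (hH : Continuous H) (ε δ : ℝ) :
    IsClosed {x | AlmostAffineAt H ε δ x} := by
  have hS : IsClosed {p : Icc δ δ⁻¹ × ℝ | ∀ t ∈ Icc (-δ) δ,
      |H (p.2 + t) - H p.2 - (p.1 : ℝ) * t| ≤ ε * (p.1 : ℝ) * |t|} := by
    have e : {p : Icc δ δ⁻¹ × ℝ | ∀ t ∈ Icc (-δ) δ,
        |H (p.2 + t) - H p.2 - (p.1 : ℝ) * t| ≤ ε * (p.1 : ℝ) * |t|} =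
        ⋂ t ∈ Icc (-δ) δ, {p : Icc δ δ⁻¹ × ℝ |
          |H (p.2 + t) - H p.2 - (p.1 : ℝ) * t| ≤ ε * (p.1 : ℝ) * |t|} := by
      ext p; simp
    rw [e]
    refine isClosed_biInter fun t _ => isClosed_le ?_ ?_ <;> fun_prop
  have := isClosedMap_snd_of_compactSpace (X := Icc δ δ⁻¹) (Y := ℝ) _ hS
  convert this using 1
  ext x
  constructor
  · rintro ⟨ρ, hρ, h⟩
    exact ⟨(⟨ρ, hρ⟩, x), h, rfl⟩
  · rintro ⟨⟨ρ, y⟩, h, rfl⟩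
    exact ⟨ρ, ρ.2, h⟩

lemma HasDerivAt.exists_almostAffineAt {H : ℝ → ℝ} {g x ε : ℝ} (h : HasDerivAt H g x) (hg : 0 < g)
    (hε : 0 < ε) : ∃ n : ℕ, AlmostAffineAt H ε (1 / (n + 1)) x := by
  have h1 := (hasDerivAt_iff_isLittleO_nhds_zero.1 h).def (mul_pos hε hg)
  obtain ⟨δ, hδ, h2⟩ := Metric.eventually_nhds_iff.1 h1
  obtain ⟨n₁, hn₁⟩ := exists_nat_one_div_lt (lt_min hδ hg)
  obtain ⟨n₂, hn₂⟩ := exists_nat_ge g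
  refine ⟨max n₁ n₂, g, ⟨?_, ?_⟩, fun t ht => ?_⟩
  · exact (Nat.one_div_le_one_div (le_max_left n₁ n₂)).trans (hn₁.le.trans (min_le_right _ _))
  · rw [one_div, inv_inv]
    have : (n₂ : ℝ) ≤ (max n₁ n₂ : ℕ) := by exact_mod_cast le_max_right _ _
    linarith
  · have hb := (Nat.one_div_le_one_div (α := ℝ) (le_max_left n₁ n₂)).trans_lt
      (hn₁.trans_le (min_le_left _ _))
    have h3 := h2 (y := t) (by
      rw [Real.dist_0_eq_abs]
      exact (abs_le.2 ht).trans_lt hb)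
    rw [smul_eq_mul, mul_comm t g] at h3
    exact h3

lemma CircleHomeo.toFun_iterate_projC (G : CircleHomeo) (m : ℕ) (x : ℝ) :
    G.toFun^[m] (projC x) = projC (G.lift^[m] x) := by
  induction m with
  | zero => rfl
  | succ m ih => rw [Function.iterate_succ_apply', ih, G.toFun_projC, Function.iterate_succ_apply']

/-- If the invariant measure is absolutely continuous, its distribution function is almost affine
near some point and near its `m`-th image, at a scale independent of `m`. -/
lemma CircleHomeo.exists_almostAffineAt (G : CircleHomeo) {μ : Measure Circle1}
    [IsProbabilityMeasure μ] (hinv : μ.map G.toFun = μ) (hac : μ ≪ volume) {H : ℝ → ℝ}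
    (hc : Continuous H) (h1 : ∀ x, H (x + 1) = H x + 1)
    (hd : ∀ᵐ x : ℝ, HasDerivAt H (μ.rnDeriv volume (projC x)).toReal x) {ε : ℝ} (hε : 0 < ε) :
    ∃ δ > 0, ∀ m : ℕ, ∃ x, AlmostAffineAt H ε δ x ∧ AlmostAffineAt H ε δ (G.lift^[m] x) := by
  set E : ℕ → Set ℝ := fun n => {x | AlmostAffineAt H ε (1 / (n + 1)) x} with hE
  set A : ℕ → Set Circle1 := fun n => projC '' E n with hA
  have hpre : ∀ n, projC ⁻¹' (A n) = E n := by
    intro n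
    refine Subset.antisymm ?_ (subset_preimage_image _ _)
    rintro x ⟨y, hy, hyx⟩
    obtain ⟨k, rfl⟩ := projC_eq_iff.1 hyx.symm
    exact AlmostAffineAt.add_int h1 hy k
  have hAc : ∀ n, IsClosed (A n) := by
    intro n
    have hq : Topology.IsQuotientMap projC := QuotientAddGroup.isQuotientMap_mk _
    rw [← hq.isClosed_preimage, hpre]
    exact isClosed_almostAffineAt hc _ _
  have hmono : Monotone A := by
    intro m n hmn
    refine image_mono fun x hx => ?_
    exact AlmostAffineAt.mono hx (by positivity) (Nat.one_div_le_one_div hmn)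
  have hnull : μ (⋃ n, A n)ᶜ = 0 := by
    have hD0 : volume (projC '' {x | ¬ HasDerivAt H (μ.rnDeriv volume (projC x)).toReal x}) = 0 :=
      volume_projC_image_eq_zero hd
    have e1 : ∀ᵐ z ∂μ, 0 < μ.rnDeriv volume z := Measure.rnDeriv_pos hac
    have e2 : ∀ᵐ z ∂μ, μ.rnDeriv volume z < ⊤ := hac.ae_le (Measure.rnDeriv_lt_top μ volume)
    have e3 : ∀ᵐ z ∂μ, z ∉ projC '' {x | ¬ HasDerivAt H (μ.rnDeriv volume (projC x)).toReal x} :=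
      measure_eq_zero_iff_ae_notMem.1 (hac hD0)
    have e4 : ∀ᵐ z ∂μ, z ∈ ⋃ n, A n := by
      filter_upwards [e1, e2, e3] with z h₁ h₂ h₃
      obtain ⟨x, rfl⟩ := projC_surjective z
      have hx : HasDerivAt H (μ.rnDeriv volume (projC x)).toReal x := by
        by_contra hx
        exact h₃ ⟨x, hx, rfl⟩
      obtain ⟨n, hn⟩ := hx.exists_almostAffineAt (ENNReal.toReal_pos h₁.ne' h₂.ne) hε
      exact mem_iUnion.2 ⟨n, x, hn, rfl⟩
    exact e4
  have hone : μ (⋃ n, A n) = 1 := by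
    rwa [prob_compl_eq_zero_iff (MeasurableSet.iUnion fun n => (hAc n).measurableSet)] at hnull
  have hlim : Tendsto (μ ∘ A) atTop (nhds 1) := hone ▸ tendsto_measure_iUnion_atTop hmono
  obtain ⟨n, hn⟩ := (hlim.eventually (lt_mem_nhds (a := (1 / 2 : ℝ≥0∞)) (by
    rw [one_div]; exact ENNReal.inv_lt_one.2 (by norm_num)))).exists
  refine ⟨1 / (n + 1), by positivity, fun m => ?_⟩
  have hT : MeasurePreserving G.toFun μ μ := ⟨G.measurable_toFun, hinv⟩
  have hTm := (hT.iterate m).measure_preimage (hAc n).measurableSet.nullMeasurableSet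
  have hne : (A n ∩ G.toFun^[m] ⁻¹' (A n)).Nonempty := by
    refine nonempty_inter_of_measure_lt_add μ
      ((hT.iterate m).measurable (hAc n).measurableSet) (u := univ) (subset_univ _)
      (subset_univ _) ?_
    rw [hTm, measure_univ]
    change 1 / 2 < μ (A n) at hn
    calc (1 : ℝ≥0∞) = 1 / 2 + 1 / 2 := (ENNReal.add_halves 1).symm
      _ < μ (A n) + μ (A n) := ENNReal.add_lt_add hn hn
  obtain ⟨z, hz1, hz2⟩ := hne
  obtain ⟨x, rfl⟩ := projC_surjective z
  refine ⟨x, ?_, ?_⟩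
  · have : x ∈ E n := by rw [← hpre]; exact hz1
    exact this
  · have : G.lift^[m] x ∈ E n := by
      rw [← hpre, mem_preimage, ← G.toFun_iterate_projC]; exact hz2
    exact this

/-- `p / q` is a fraction in lowest terms approximating `β` at Dirichlet's rate. -/
structure IsDirichletApprox (β : ℝ) (p : ℤ) (q : ℕ) : Prop where
  pos : 0 < q
  coprime : IsCoprime p (q : ℤ)
  abs_mul_sub_le : ∀ k : ℕ, k < q → |k * β - k * p / q| ≤ 1 / q

lemma exists_isDirichletApprox {β : ℝ} (hβ : Irrational β) (Q : ℕ) :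
    ∃ p q, Q ≤ q ∧ IsDirichletApprox β p q := by
  have hinf := Real.infinite_rat_abs_sub_lt_one_div_den_sq_of_irrational hβ
  have hfin : {r : ℚ | |β - r| < 1 / (r.den : ℝ) ^ 2 ∧ r.den < Q}.Finite := by
    refine ((finite_Icc (-⌈(|β| + 1) * Q⌉) ⌈(|β| + 1) * Q⌉).prod (finite_Iio Q)).of_injOn
      (f := fun r : ℚ => (r.num, r.den)) ?_ ?_
    · rintro r ⟨hr, hrQ⟩
      have hd : (1 : ℝ) ≤ r.den := by exact_mod_cast r.pos
      have hdQ : (r.den : ℝ) ≤ Q := by exact_mod_cast hrQ.le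
      have h1 : |(r : ℝ)| ≤ |β| + 1 := by
        have h2 : 1 / (r.den : ℝ) ^ 2 ≤ 1 := by
          rw [div_le_one (by positivity)]; exact one_le_pow₀ hd
        have h3 := abs_sub_abs_le_abs_sub (r : ℝ) β
        rw [abs_sub_comm] at h3
        linarith
      have h4 : ((r.num : ℤ) : ℝ) = r * r.den := by exact_mod_cast (Rat.mul_den_eq_num r).symm
      have h5 : |((r.num : ℤ) : ℝ)| ≤ (|β| + 1) * Q := by
        rw [h4, abs_mul, Nat.abs_cast]
        gcongr
      have h6 := h5.trans (Int.le_ceil _)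
      refine ⟨?_, hrQ⟩
      rw [abs_le] at h6
      refine mem_Icc.2 ⟨?_, ?_⟩
      · exact_mod_cast h6.1
      · exact_mod_cast h6.2
    · intro r _ r' _ h
      simp only [Prod.mk.injEq] at h
      exact Rat.ext h.1 h.2
  obtain ⟨r, hr, hrQ⟩ := (hinf.sdiff hfin).nonempty
  have hrQ' : Q ≤ r.den := by
    by_contra h
    exact hrQ ⟨hr, not_le.1 h⟩
  have hd : (0 : ℝ) < r.den := by exact_mod_cast r.pos
  refine ⟨r.num, r.den, hrQ', r.pos, ?_, fun k hk => ?_⟩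
  · rw [Int.isCoprime_iff_gcd_eq_one]
    exact r.reduced
  · have hr' : |β - r| < 1 / (r.den : ℝ) ^ 2 := hr
    have e : (k : ℝ) * β - k * (r.num : ℝ) / r.den = k * (β - r) := by
      rw [mul_sub, mul_div_assoc, Rat.cast_def]
    have hk' : (k : ℝ) ≤ r.den := by exact_mod_cast hk.le
    rw [e, abs_mul, Nat.abs_cast]
    calc (k : ℝ) * |β - r| ≤ r.den * (1 / (r.den : ℝ) ^ 2) := by gcongr
      _ = 1 / r.den := by field_simp

namespace IsDirichletApprox

variable {β : ℝ} {p : ℤ} {q : ℕ}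

lemma exists_abs_sub_le (h : IsDirichletApprox β p q) (t : ℝ) :
    ∃ k < q, ∃ l : ℤ, |t + l - k * β| ≤ 2 / q := by
  obtain ⟨a, b, hab⟩ := h.coprime
  have hq : (0 : ℝ) < q := by exact_mod_cast h.pos
  have hqz : (0 : ℤ) < q := by exact_mod_cast h.pos
  set n := round (q * t) with hn
  have hk0 := Int.emod_nonneg (n * a) hqz.ne'
  have hk1 := Int.emod_lt_of_pos (n * a) hqz
  obtain ⟨k, hk⟩ := Int.eq_ofNat_of_zero_le hk0
  have hkq : k < q := by omega
  have hdiv := Int.emod_add_mul_ediv (n * a) q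
  rw [hk] at hdiv
  set m := n * a / (q : ℤ) with hm
  have hkp : (k : ℤ) * p = n + q * (-(n * b) - m * p) := by
    linear_combination p * hdiv + n * hab
  refine ⟨k, hkq, -(n * b) - m * p, ?_⟩
  have hkp' : (k : ℝ) * p = n + q * ((-(n * b) - m * p : ℤ) : ℝ) := by exact_mod_cast hkp
  have h1 := h.abs_mul_sub_le k hkq
  have h2 := abs_sub_round (q * t)
  have e : t + ((-(n * b) - m * p : ℤ) : ℝ) - k * β =
      (q * t - n) / q - (k * β - k * p / q) := by
    rw [hkp']; field_simp; ring
  rw [e]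
  refine (abs_sub _ _).trans ?_
  rw [abs_div, abs_of_pos hq]
  have h3 : |(q : ℝ) * t - n| / q ≤ 1 / q := by gcongr; linarith
  calc _ ≤ 1 / (q : ℝ) + 1 / q := add_le_add h3 h1
    _ = 2 / q := by ring

lemma card_le (h : IsDirichletApprox β p q) {u v t : ℝ} {m : ℕ} (huv : v - u ≤ m / q)
    {s : Finset ℕ} (hs : ∀ k ∈ s, k < q)
    (hst : ∀ k ∈ s, ∃ l : ℤ, u ≤ t + l - k * β ∧ t + l - k * β ≤ v) : s.card ≤ m + 3 := by
  have hq : (0 : ℝ) < q := by exact_mod_cast h.pos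
  have hqz : (0 : ℤ) < q := by exact_mod_cast h.pos
  choose! l hl using hst
  have huv' : q * (v - u) ≤ m := by rwa [le_div_iff₀ hq, mul_comm] at huv
  have hcard := Finset.card_le_card_of_injOn (t := Finset.Icc ⌈q * (u - t) - 1⌉ ⌊q * (v - t) + 1⌋)
    (s := s) (fun k => l k * q - k * p) ?_ ?_
  · refine hcard.trans ?_
    rw [Int.card_Icc, Int.toNat_le]
    have h1 := Int.floor_le (q * (v - t) + 1)
    have h2 := Int.le_ceil (q * (u - t) - 1)
    have h3 : ((⌊q * (v - t) + 1⌋ + 1 - ⌈q * (u - t) - 1⌉ : ℤ) : ℝ) ≤ ((m + 3 : ℕ) : ℤ) := by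
      push_cast; linarith
    exact_mod_cast h3
  · intro k hk
    obtain ⟨h1, h2⟩ := hl k hk
    have h3 := abs_le.1 (h.abs_mul_sub_le k (hs k hk))
    have e1 : q * (1 / (q : ℝ)) = 1 := by field_simp
    have e2 : q * (k * β - k * p / q) = q * (k * β) - k * p := by field_simp
    have h4 := mul_le_mul_of_nonneg_left h3.1 hq.le
    have h5 := mul_le_mul_of_nonneg_left h3.2 hq.le
    have h6 := mul_le_mul_of_nonneg_left h1 hq.le
    have h7 := mul_le_mul_of_nonneg_left h2 hq.le
    rw [Finset.coe_Icc, mem_Icc, Int.ceil_le, Int.le_floor]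
    push_cast
    constructor <;> linarith
  · intro k hk k' hk' hkk
    have hk1 := hs k hk
    have hk2 := hs k' hk'
    have hdvd : (q : ℤ) ∣ (k - k') * p := ⟨l k - l k', by simp only at hkk; linarith⟩
    have hdvd' := h.coprime.symm.dvd_of_dvd_mul_right hdvd
    have := Int.eq_zero_of_abs_lt_dvd hdvd' (by rw [abs_lt]; constructor <;> omega)
    omega

end IsDirichletApprox

/-- `H` is a monotone degree-one map semiconjugating the lift of `G` to the translation by `β`. -/
structure CircleHomeo.IsLinearizedBy (G : CircleHomeo) (H : ℝ → ℝ) (β : ℝ) : Prop where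
  continuous : Continuous H
  monotone : Monotone H
  add_one : ∀ x, H (x + 1) = H x + 1
  map_lift : ∀ x, H (G.lift x) = H x + β

namespace CircleHomeo.IsLinearizedBy

variable {G : CircleHomeo} {H : ℝ → ℝ} {β : ℝ}

lemma map_iterate (h : G.IsLinearizedBy H β) (n : ℕ) (x : ℝ) :
    H (G.lift^[n] x) = H x + n * β := by
  induction n with
  | zero => simp
  | succ n ih => rw [Function.iterate_succ_apply', h.map_lift, ih]; push_cast; ring

lemma lt_add_one (h : G.IsLinearizedBy H β) {a b : ℝ} (hab : H b - H a < 1) : b < a + 1 := by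
  by_contra hba
  have := h.monotone (not_lt.1 hba)
  rw [h.add_one] at this
  linarith

lemma surjective (h : G.IsLinearizedBy H β) : Function.Surjective H := by
  intro y
  have hk : ∀ k : ℤ, H (0 + k) = H 0 + k := add_int_of_add_one h.add_one 0
  refine mem_range_of_exists_le_of_exists_ge h.continuous ⟨0 + (⌊y - H 0⌋ : ℤ), ?_⟩
    ⟨0 + (⌈y - H 0⌉ : ℤ), ?_⟩
  · rw [hk]; linarith [Int.floor_le (y - H 0)]
  · rw [hk]; linarith [Int.le_ceil (y - H 0)]

/-- The first `q` iterates of an interval of measure at most `m / q` cover the circle at most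
`m + 3` times. -/
lemma sum_sub_le (h : G.IsLinearizedBy H β) {p : ℤ} {q m : ℕ} (hq : IsDirichletApprox β p q)
    (hmq : m < q) {a b : ℝ} (hab : a ≤ b) (hH : H b - H a ≤ m / q) :
    ∑ j ∈ Finset.range q, (G.lift^[j] b - G.lift^[j] a) ≤ m + 3 := by
  classical
  have hq0 : (0 : ℝ) < q := by exact_mod_cast hq.pos
  have hm1 : (m : ℝ) / q < 1 := by rw [div_lt_one hq0]; exact_mod_cast hmq
  have hle : ∀ j, G.lift^[j] a ≤ G.lift^[j] b := fun j =>
    (G.lift_strictMono.iterate j).monotone hab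
  have hle1 : ∀ j, G.lift^[j] b ≤ G.lift^[j] a + 1 := fun j =>
    (h.lt_add_one (by rw [h.map_iterate, h.map_iterate]; linarith)).le
  set I : ℕ → Set Circle1 := fun j => projC '' Ioc (G.lift^[j] a) (G.lift^[j] b) with hI
  have hsub : ∀ j, Ioc (G.lift^[j] a) (G.lift^[j] b) ⊆ Ioc (G.lift^[j] a) (G.lift^[j] a + 1) :=
    fun j => Ioc_subset_Ioc_right (hle1 j)
  have hIm : ∀ j, MeasurableSet (I j) :=
    fun j => measurableSet_projC_image measurableSet_Ioc (hsub j)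
  have hvol : ∀ j, ENNReal.ofReal (G.lift^[j] b - G.lift^[j] a) = ∫⁻ z, (I j).indicator 1 z := by
    intro j
    rw [lintegral_indicator_one (hIm j), hI, volume_projC_image measurableSet_Ioc (hsub j),
      Real.volume_Ioc]
  have hcount : ∀ z, ∑ j ∈ Finset.range q, (I j).indicator (1 : Circle1 → ℝ≥0∞) z ≤ (m + 3 : ℕ) := by
    intro z
    obtain ⟨x, rfl⟩ := projC_surjective z
    rw [show (∑ j ∈ Finset.range q, (I j).indicator (1 : Circle1 → ℝ≥0∞) (projC x)) =
      (((Finset.range q).filter fun j => projC x ∈ I j).card : ℝ≥0∞) by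
        rw [Finset.card_filter]; push_cast
        exact Finset.sum_congr rfl fun j _ => by simp [indicator_apply]]
    refine Nat.cast_le.2 (hq.card_le (u := H a) (v := H b) (t := H x) hH
      (fun k hk => Finset.mem_range.1 (Finset.mem_filter.1 hk).1) fun k hk => ?_)
    obtain ⟨y, hy, hyx⟩ := (Finset.mem_filter.1 hk).2
    obtain ⟨l, rfl⟩ := projC_eq_iff.1 hyx
    have h1 := h.monotone hy.1.le
    have h2 := h.monotone hy.2
    rw [add_int_of_add_one h.add_one, h.map_iterate] at h1 h2
    exact ⟨l, by linarith, by linarith⟩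
  have hfin : ENNReal.ofReal (∑ j ∈ Finset.range q, (G.lift^[j] b - G.lift^[j] a)) ≤
      ENNReal.ofReal (m + 3) := by
    rw [ENNReal.ofReal_sum_of_nonneg fun j _ => sub_nonneg.2 (hle j),
      Finset.sum_congr rfl fun j _ => hvol j,
      ← lintegral_finsetSum _ fun j _ => measurable_one.indicator (hIm j)]
    refine (lintegral_mono hcount).trans ?_
    rw [lintegral_const, AddCircle.measure_univ, ENNReal.ofReal_one, mul_one]
    refine le_of_eq ?_
    rw [← ENNReal.ofReal_natCast]; push_cast; rfl
  exact (ENNReal.ofReal_le_ofReal_iff (by positivity)).1 hfin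

end CircleHomeo.IsLinearizedBy

lemma exp_neg_sum_mul_le {X s : ℕ → ℝ} {n : ℕ}
    (h : ∀ j < n, Real.exp (-(s j)) * X j ≤ X (j + 1)) :
    Real.exp (-(∑ j ∈ Finset.range n, s j)) * X 0 ≤ X n := by
  induction n with
  | zero => simp
  | succ n ih =>
    have h1 := ih fun j hj => h j (hj.trans n.lt_succ_self)
    rw [Finset.sum_range_succ, neg_add_rev, Real.exp_add, mul_assoc]
    exact (mul_le_mul_of_nonneg_left h1 (Real.exp_pos _).le).trans (h n n.lt_succ_self)

namespace MulticriticalCircleMap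

variable (f : MulticriticalCircleMap) {H : ℝ → ℝ} {β : ℝ}

open scoped Classical in
lemma card_crossing_le (h : f.IsLinearizedBy H β) {p : ℤ} {q m : ℕ}
    (hq : IsDirichletApprox β p q) {a d : ℝ} (hH : H d - H a ≤ m / q) :
    ((Finset.range q).filter fun j : ℕ =>
      ∃ z ∈ f.critLift, f.lift^[j] a < z ∧ z < f.lift^[j] d).card ≤ f.N * (m + 3) := by
  set S : Fin f.N → Finset ℕ := fun i => (Finset.range q).filter fun j : ℕ =>
    ∃ l : ℤ, H a ≤ H (f.crit i) + l - j * β ∧ H (f.crit i) + l - j * β ≤ H d with hS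
  refine (Finset.card_le_card (t := Finset.univ.biUnion S) ?_).trans ?_
  · intro j hj
    obtain ⟨hjq, z, ⟨i, l, rfl⟩, hz1, hz2⟩ := Finset.mem_filter.1 hj
    refine Finset.mem_biUnion.2 ⟨i, Finset.mem_univ _, Finset.mem_filter.2 ⟨hjq, l, ?_⟩⟩
    have h1 := h.monotone hz1.le
    have h2 := h.monotone hz2.le
    rw [add_int_of_add_one h.add_one, h.map_iterate] at h1 h2
    exact ⟨by linarith, by linarith⟩
  · refine (Finset.card_biUnion_le_card_mul _ _ (m + 3) fun i _ => ?_).trans (by simp)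
    exact hq.card_le hH (fun k hk => Finset.mem_range.1 (Finset.mem_filter.1 hk).1)
      fun k hk => (Finset.mem_filter.1 hk).2

/-- Cross-ratios of quadruples of small measure are not contracted by more than a uniform factor
under the first `q` iterates. -/
lemma exists_iterate_crossRatio_ge (m : ℕ) : ∃ Λ : ℝ, ∀ {H : ℝ → ℝ} {β : ℝ},
    f.IsLinearizedBy H β → ∀ {p : ℤ} {q : ℕ}, IsDirichletApprox β p q → m < q →
    ∀ {a b c d : ℝ}, a < b → b < c → c < d → H d - H a ≤ m / q → ∀ n ≤ q,
    Real.exp (-Λ) * crossRatio a b c d ≤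
      crossRatio (f.lift^[n] a) (f.lift^[n] b) (f.lift^[n] c) (f.lift^[n] d) := by
  classical
  obtain ⟨κ, hκ, C, hC, hX⟩ := f.exists_crossRatio_inequality
  refine ⟨κ * (f.N * (m + 3)) + C * (m + 3), ?_⟩
  intro H β h p q hq hmq a b c d hab hbc hcd hH n hn
  have hq0 : (0 : ℝ) < q := by exact_mod_cast hq.pos
  have hm1 : (m : ℝ) / q < 1 := by rw [div_lt_one hq0]; exact_mod_cast hmq
  set P : ℕ → Prop := fun j => ∃ z ∈ f.critLift, f.lift^[j] a < z ∧ z < f.lift^[j] d with hP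
  set s : ℕ → ℝ := fun j => (if P j then κ else 0) + C * (f.lift^[j] d - f.lift^[j] a) with hs
  have hmono : ∀ j, StrictMono f.lift^[j] := fun j => f.lift_strictMono.iterate j
  have hlen : ∀ j, 0 ≤ f.lift^[j] d - f.lift^[j] a := fun j =>
    sub_nonneg.2 ((hmono j).monotone (by linarith))
  have hs0 : ∀ j, 0 ≤ s j := by
    intro j
    have h1 := mul_nonneg hC (hlen j)
    have h2 : 0 ≤ if P j then κ else 0 := by split_ifs <;> [exact hκ; exact le_rfl]
    exact add_nonneg h2 h1
  have hstep := exp_neg_sum_mul_le (n := n) (s := s) (X := fun j =>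
    crossRatio (f.lift^[j] a) (f.lift^[j] b) (f.lift^[j] c) (f.lift^[j] d)) (by
      intro j _
      have hd1 : f.lift^[j] d ≤ f.lift^[j] a + 1 :=
        (h.lt_add_one (by rw [h.map_iterate, h.map_iterate]; linarith)).le
      obtain ⟨h1, h2⟩ := hX _ _ _ _ (hmono j hab) (hmono j hbc) (hmono j hcd) hd1
      have hpos := crossRatio_pos (hmono j hab) (hmono j hbc) (hmono j hcd)
      simp only [Function.iterate_succ_apply']
      by_cases hPj : P j
      · refine (mul_le_mul_of_nonneg_right ?_ hpos.le).trans h1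
        refine Real.exp_le_exp.2 (neg_le_neg ?_)
        simp only [hs, if_pos hPj]
        linarith [mul_nonneg hC (hlen j)]
      · refine (mul_le_mul_of_nonneg_right ?_ hpos.le).trans
          (h2 fun z hz hz' => hPj ⟨z, hz, hz'⟩)
        simp only [hs, if_neg hPj, zero_add, le_refl])
  refine (mul_le_mul_of_nonneg_right ?_ (crossRatio_pos hab hbc hcd).le).trans hstep
  refine Real.exp_le_exp.2 (neg_le_neg ?_)
  refine (Finset.sum_le_sum_of_subset_of_nonneg (Finset.range_mono hn)
    fun j _ _ => hs0 j).trans ?_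
  simp only [hs, Finset.sum_add_distrib, ← Finset.mul_sum, ← Finset.sum_filter,
    Finset.sum_const, nsmul_eq_mul]
  have h1 := h.sum_sub_le hq hmq (by linarith : a ≤ d) hH
  have h2 : ((((Finset.range q).filter P).card : ℕ) : ℝ) ≤ (f.N * (m + 3) : ℕ) := by
    exact_mod_cast f.card_crossing_le h hq hH
  push_cast at h2
  rw [mul_comm κ]
  exact add_le_add (mul_le_mul_of_nonneg_right h2 hκ) (mul_le_mul_of_nonneg_left h1 hC)

end MulticriticalCircleMap

lemma AlmostAffineAt.exists_slope {H : ℝ → ℝ} {ε δ x r : ℝ} (h : AlmostAffineAt H ε δ x)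
    (hm : Monotone H) (hδ : 0 < δ) (hε : ε ≤ 1 / 2) (hr : r < δ ^ 2 / 2) :
    ∃ ρ > 0, ∀ u v, |H u - H x| ≤ r → |H v - H x| ≤ r →
      |H u - H v - ρ * (u - v)| ≤ 4 * ε * r := by
  obtain ⟨ρ, hρ, h⟩ := h
  have hρ0 : 0 < ρ := hδ.trans_le hρ.1
  refine ⟨ρ, hρ0, ?_⟩
  have hε0 : 0 ≤ ε := by
    have h1 := (abs_nonneg _).trans (h δ ⟨by linarith, le_rfl⟩)
    have h2 : 0 < ρ * |δ| := by positivity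
    rw [mul_assoc] at h1
    exact nonneg_of_mul_nonneg_left h1 h2
  have hρδ : δ ^ 2 ≤ ρ * δ := by nlinarith [hρ.1]
  have hερδ : ε * ρ * δ ≤ 1 / 2 * (ρ * δ) := by
    rw [mul_assoc]; gcongr
  have key : ∀ u, |H u - H x| ≤ r → |H u - H x - ρ * (u - x)| ≤ 2 * ε * r := by
    intro u hu
    rw [abs_le] at hu
    have h1 : u - x ≤ δ := by
      by_contra hc
      have h2 := hm (by linarith : x + δ ≤ u)
      have h3 := (abs_le.1 (h δ ⟨by linarith, le_rfl⟩)).1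
      rw [abs_of_pos hδ] at h3
      linarith
    have h1' : -δ ≤ u - x := by
      by_contra hc
      have h2 := hm (by linarith : u ≤ x + -δ)
      have h3 := (abs_le.1 (h (-δ) ⟨le_rfl, by linarith⟩)).2
      rw [abs_neg, abs_of_pos hδ] at h3
      linarith
    have h4 := h (u - x) ⟨h1', h1⟩
    rw [add_sub_cancel] at h4
    have h5 : ρ * |u - x| ≤ 2 * r := by
      have h6 : |ρ * (u - x)| ≤ |H u - H x| + |H u - H x - ρ * (u - x)| := by
        have := abs_sub (H u - H x) (H u - H x - ρ * (u - x))
        rwa [sub_sub_cancel] at this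
      rw [abs_mul, abs_of_pos hρ0] at h6
      have h7 : ε * ρ * |u - x| ≤ 1 / 2 * (ρ * |u - x|) := by
        rw [mul_assoc]; gcongr
      have h8 := abs_le.2 hu
      linarith
    calc _ ≤ ε * ρ * |u - x| := h4
      _ = ε * (ρ * |u - x|) := by ring
      _ ≤ ε * (2 * r) := by gcongr
      _ = 2 * ε * r := by ring
  intro u v hu hv
  have h1 := key u hu
  have h2 := key v hv
  rw [abs_le] at h1 h2 ⊢
  constructor <;> linarith [h1.1, h1.2, h2.1, h2.2]

lemma crossRatio_eq_scaled (a b c d : ℝ) {ρ : ℝ} (hρ : 0 < ρ) : crossRatio a b c d =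
    ((ρ * (c - a)) * (ρ * (d - b))) / ((ρ * (b - a)) * (ρ * (d - c))) := by
  unfold crossRatio
  rw [mul_mul_mul_comm, mul_mul_mul_comm ρ (b - a), mul_div_mul_left _ _ (by positivity)]

lemma crossRatio_le_of_scaled {a b c d ρ P M : ℝ} (hρ : 0 < ρ) (hM : 0 < M) (hP : 0 ≤ P)
    (h1 : ρ * (c - a) ≤ P) (h2 : ρ * (d - b) ≤ P) (h2' : 0 ≤ d - b) (h3 : M ≤ ρ * (b - a))
    (h4 : M ≤ ρ * (d - c)) : crossRatio a b c d ≤ (P / M) ^ 2 := by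
  rw [crossRatio_eq_scaled a b c d hρ, div_pow, pow_two, pow_two]
  exact div_le_div₀ (by positivity) (mul_le_mul h1 h2 (by positivity) hP) (by positivity)
    (mul_le_mul h3 h4 hM.le (hM.le.trans h3))

lemma le_crossRatio_of_scaled {a b c d ρ P M : ℝ} (hρ : 0 < ρ) (hM : 0 ≤ M)
    (h1 : M ≤ ρ * (c - a)) (h2 : M ≤ ρ * (d - b)) (hab : a < b) (hcd : c < d)
    (h3 : ρ * (b - a) ≤ P) (h4 : ρ * (d - c) ≤ P) : (M / P) ^ 2 ≤ crossRatio a b c d := by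
  have h5 : 0 < ρ * (b - a) := mul_pos hρ (sub_pos.2 hab)
  have h6 : 0 < ρ * (d - c) := mul_pos hρ (sub_pos.2 hcd)
  rw [crossRatio_eq_scaled a b c d hρ, div_pow, pow_two, pow_two]
  exact div_le_div₀ (mul_nonneg (hM.trans h1) (hM.trans h2)) (mul_le_mul h1 h2 hM (hM.trans h1))
    (by positivity) (mul_le_mul h3 h4 h6.le (h5.le.trans h3))

namespace MulticriticalCircleMap

variable (f : MulticriticalCircleMap) {H : ℝ → ℝ} {β : ℝ}

lemma strictMono_of_almostAffineAt (h : f.IsLinearizedBy H β) (hβ : Irrational β)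
    (hE : ∀ ε > 0, ∃ δ > 0, ∃ x, AlmostAffineAt H ε δ x) : StrictMono H := by
  refine h.monotone.strictMono_of_injective ?_
  by_contra hinj
  have hex : ∃ u₀ v₀, u₀ < v₀ ∧ H u₀ = H v₀ := by
    rw [Function.Injective] at hinj
    push Not at hinj
    obtain ⟨u₀, v₀, he, hne⟩ := hinj
    rcases lt_or_gt_of_ne hne with hlt | hlt
    · exact ⟨u₀, v₀, hlt, he⟩
    · exact ⟨v₀, u₀, hlt, he.symm⟩
  obtain ⟨u₀, v₀, huv₀, he₀⟩ := hex
  set K : Set ℝ := H ⁻¹' {H u₀} with hK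
  have hKc : IsCompact K := by
    refine isCompact_Icc.of_isClosed_subset (isClosed_singleton.preimage h.continuous)
      (?_ : K ⊆ Icc (u₀ - 1) (u₀ + 1))
    intro y hy
    have hy' : H y = H u₀ := hy
    have h1 : y < u₀ + 1 := h.lt_add_one (by linarith)
    have h2 : u₀ < y + 1 := h.lt_add_one (by linarith)
    exact ⟨by linarith, by linarith⟩
  obtain ⟨u, huK, hul⟩ := hKc.exists_isLeast ⟨u₀, rfl⟩
  obtain ⟨v, hvK, hvg⟩ := hKc.exists_isGreatest ⟨u₀, rfl⟩
  have huK' : H u = H u₀ := huK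
  have hvK' : H v = H u₀ := hvK
  have huv : u < v := (hul (show H u₀ = H u₀ from rfl)).trans_lt (huv₀.trans_le (hvg he₀.symm))
  obtain ⟨Λ, hΛ⟩ := f.exists_iterate_crossRatio_ge 8
  set D := v - u with hD
  have hD0 : 0 < D := sub_pos.2 huv
  set τ := D * Real.exp (-Λ / 2) / 2 with hτ
  have hτ0 : 0 < τ := by positivity
  have hσ1 : H (u - τ) < H u := by
    refine lt_of_le_of_ne (h.monotone (by linarith)) fun he => ?_
    have : u ≤ u - τ := hul (show H (u - τ) = H u₀ by rw [he, huK'])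
    linarith
  have hσ2 : H v < H (v + τ) := by
    refine lt_of_le_of_ne (h.monotone (by linarith)) fun he => ?_
    have : v + τ ≤ v := hvg (show H (v + τ) = H u₀ by rw [← he, hvK'])
    linarith
  obtain ⟨δ, hδ, x, hx⟩ := hE (1 / 100) (by norm_num)
  set σ := min (min (H u - H (u - τ)) (H (v + τ) - H v)) (δ ^ 2 / 2) with hσ
  have hσ0 : 0 < σ := lt_min (lt_min (by linarith) (by linarith)) (by positivity)
  obtain ⟨Q, hQ⟩ := exists_nat_gt (max 8 (6 / σ))
  obtain ⟨p, q, hQq, hq⟩ := exists_isDirichletApprox hβ Q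
  have hqQ : max 8 (6 / σ) < (q : ℝ) := hQ.trans_le (by exact_mod_cast hQq)
  have hq0 : (0 : ℝ) < q := by exact_mod_cast hq.pos
  have h8q : 8 < q := by exact_mod_cast (le_max_left _ _).trans_lt hqQ
  have h6q : 6 / (q : ℝ) < σ := by
    rw [div_lt_comm₀ hq0 hσ0]; exact (le_max_right _ _).trans_lt hqQ
  have e4 : 4 / (q : ℝ) = 4 * (1 / q) := by ring
  have e6 : 6 / (q : ℝ) = 6 * (1 / q) := by ring
  have e8 : 8 / (q : ℝ) = 8 * (1 / q) := by ring
  have e2 : 2 / (q : ℝ) = 2 * (1 / q) := by ring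
  have hi : 0 < 1 / (q : ℝ) := by positivity
  have hσ3 : σ ≤ H u - H (u - τ) := (min_le_left _ _).trans (min_le_left _ _)
  have hσ4 : σ ≤ H (v + τ) - H v := (min_le_left _ _).trans (min_le_right _ _)
  obtain ⟨a, ha⟩ := h.surjective (H u - 4 / q)
  obtain ⟨d, hd⟩ := h.surjective (H v + 4 / q)
  have hau : a < u := h.monotone.reflect_lt (by linarith)
  have hvd : v < d := h.monotone.reflect_lt (by linarith)
  have hau' : u - τ < a := h.monotone.reflect_lt (by linarith)
  have hvd' : d < v + τ := h.monotone.reflect_lt (by linarith)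
  have hX0 : 4 * Real.exp Λ ≤ crossRatio a u v d := by
    have h1 : (D / τ) ^ 2 ≤ crossRatio a u v d :=
      le_crossRatio_of_scaled one_pos hD0.le (by linarith) (by linarith) hau hvd (by linarith)
        (by linarith)
    refine le_trans (le_of_eq ?_) h1
    rw [hτ, div_pow, div_pow, mul_pow, ← Real.exp_nat_mul]
    rw [show ((2 : ℕ) : ℝ) * (-Λ / 2) = -Λ by push_cast; ring, Real.exp_neg]
    field_simp
    norm_num
  obtain ⟨k, hkq, l, hkl⟩ := hq.exists_abs_sub_le (H x - H u)
  have hXk := hΛ h hq h8q hau huv hvd (by rw [ha, hd, huK', hvK']; push_cast; linarith) k hkq.le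
  have h4 : 4 ≤ crossRatio (f.lift^[k] a) (f.lift^[k] u) (f.lift^[k] v) (f.lift^[k] d) := by
    refine le_trans ?_ hXk
    have := mul_le_mul_of_nonneg_left hX0 (Real.exp_pos (-Λ)).le
    rw [mul_left_comm, ← Real.exp_add, neg_add_cancel, Real.exp_zero, mul_one] at this
    exact this
  rw [← crossRatio_add _ _ _ _ ((-l : ℤ) : ℝ)] at h4
  obtain ⟨ρ, hρ, hslope⟩ := hx.exists_slope h.monotone hδ (by norm_num)
    (h6q.trans_le (min_le_right _ _))
  have hHk : ∀ y, H (f.lift^[k] y + ((-l : ℤ) : ℝ)) = H y + k * β - l := by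
    intro y
    rw [add_int_of_add_one h.add_one, h.map_iterate]; push_cast; ring
  rw [abs_le] at hkl
  have hnear : ∀ y, |H y - H u| ≤ 4 / q → |H (f.lift^[k] y + ((-l : ℤ) : ℝ)) - H x| ≤ 6 / q := by
    intro y hy
    rw [hHk]
    rw [abs_le] at hy ⊢
    constructor <;> linarith
  have hna := hnear a (by rw [ha, abs_le]; constructor <;> linarith)
  have hnu := hnear u (by rw [abs_le]; constructor <;> linarith)
  have hnv := hnear v (by rw [hvK', huK', abs_le]; constructor <;> linarith)
  have hnd := hnear d (by rw [hd, hvK', huK', abs_le]; constructor <;> linarith)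
  have s1 := abs_le.1 (hslope _ _ hnu hna)
  have s2 := abs_le.1 (hslope _ _ hnv hna)
  have s3 := abs_le.1 (hslope _ _ hnd hnu)
  have s4 := abs_le.1 (hslope _ _ hnd hnv)
  rw [hHk, hHk] at s1 s2 s3 s4
  have hX2 := crossRatio_le_of_scaled (a := f.lift^[k] a + ((-l : ℤ) : ℝ))
    (b := f.lift^[k] u + ((-l : ℤ) : ℝ)) (c := f.lift^[k] v + ((-l : ℤ) : ℝ))
    (d := f.lift^[k] d + ((-l : ℤ) : ℝ)) (P := 4.24 * (1 / q)) (M := 3.76 * (1 / q)) hρ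
    (by positivity) (by positivity) (by linarith [s2.1]) (by linarith [s3.1])
    (sub_nonneg.2 (by
      have := (f.lift_strictMono.iterate k).monotone (huv.le.trans hvd.le)
      linarith)) (by linarith [s1.2]) (by linarith [s4.2])
  have h5 := h4.trans hX2
  rw [mul_div_mul_right _ _ hi.ne'] at h5
  norm_num at h5

end MulticriticalCircleMap

/-- A set with at most `B` points in an interval of length `B * s` has a point of that interval
followed by a gap of length `s`. -/
lemma exists_gap_of_card_le {V : Set ℝ} {h₀ s : ℝ} {B : ℕ} (hs : 0 < s) (h₀V : h₀ ∈ V)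
    (hcard : ∀ T : Finset ℝ, (∀ y ∈ T, y ∈ V ∧ h₀ ≤ y ∧ y ≤ h₀ + B * s) → T.card ≤ B) :
    ∃ y ∈ V, h₀ ≤ y ∧ y ≤ h₀ + B * s ∧ ∀ z ∈ V, ¬ (y < z ∧ z < y + s) := by
  by_contra hc
  push Not at hc
  have key : ∀ n ≤ B, ∃ T : Finset ℝ, T.card = n + 1 ∧
      (∀ y ∈ T, y ∈ V ∧ h₀ ≤ y ∧ y ≤ h₀ + n * s) ∧ ∃ y ∈ T, ∀ z ∈ T, z ≤ y := by
    intro n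
    induction n with
    | zero => intro _; exact ⟨{h₀}, by simp, by simp [h₀V], h₀, by simp, by simp⟩
    | succ n ih =>
      intro hn
      obtain ⟨T, hT, hTV, y, hyT, hy⟩ := ih (by omega)
      obtain ⟨hyV, hy₁, hy₂⟩ := hTV y hyT
      have hnB : (n : ℝ) * s ≤ B * s := by gcongr; omega
      obtain ⟨z, hzV, hyz, hzy⟩ := hc y hyV hy₁ (by linarith)
      have hzT : z ∉ T := fun h => (hy z h).not_gt hyz
      refine ⟨insert z T, by rw [Finset.card_insert_of_notMem hzT, hT], ?_, z, by simp, ?_⟩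
      · intro w hw
        push_cast
        rcases Finset.mem_insert.1 hw with rfl | hw
        · exact ⟨hzV, by linarith, by linarith⟩
        · obtain ⟨h1, h2, h3⟩ := hTV w hw
          exact ⟨h1, h2, by linarith⟩
      · intro w hw
        rcases Finset.mem_insert.1 hw with rfl | hw
        · exact le_rfl
        · exact (hy w hw).trans hyz.le
  obtain ⟨T, hT, hTV, -⟩ := key B le_rfl
  have := hcard T hTV
  omega

lemma sub_le_mul_of_crossRatio_le {a b c d K : ℝ} (hab : a < b) (hbc : b < c) (hcd : c < d)
    (h : crossRatio a b c d ≤ K) : c - b ≤ K * (d - c) := by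
  have h1 : 0 < b - a := sub_pos.2 hab
  have h2 : 0 < d - c := sub_pos.2 hcd
  have h3 : 0 < c - b := sub_pos.2 hbc
  unfold crossRatio at h
  rw [div_le_iff₀ (by positivity)] at h
  have h4 : (b - a) * (c - b) ≤ (c - a) * (d - b) :=
    mul_le_mul (by linarith) (by linarith) h3.le (by linarith)
  exact le_of_mul_le_mul_left (by linarith) h1

lemma AlmostAffineAt.crossRatio_bounds {H : ℝ → ℝ} {ε δ x r t θ a b c d : ℝ}
    (h : AlmostAffineAt H ε δ x) (hm : StrictMono H) (hδ : 0 < δ) (hε : ε ≤ 1 / 2)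
    (hr : r < δ ^ 2 / 2) (ht : 0 < t) (hθ₀ : 0 ≤ θ) (hθ : θ < 1) (hεr : 4 * ε * r ≤ θ * t)
    (ha : |H a - H x| ≤ r) (hd : |H d - H x| ≤ r)
    (hab : H b = H a + t) (hbc : H c = H b + t) (hcd : H d = H c + t) :
    ((2 - θ) / (1 + θ)) ^ 2 ≤ crossRatio a b c d ∧
      crossRatio a b c d ≤ ((2 + θ) / (1 - θ)) ^ 2 := by
  obtain ⟨ρ, hρ, hs⟩ := h.exists_slope hm.monotone hδ hε hr
  have ha' := abs_le.1 ha
  have hd' := abs_le.1 hd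
  have hb : |H b - H x| ≤ r := abs_le.2 ⟨by linarith, by linarith⟩
  have hc : |H c - H x| ≤ r := abs_le.2 ⟨by linarith, by linarith⟩
  have s1 := abs_le.1 ((hs _ _ hb ha).trans hεr)
  have s2 := abs_le.1 ((hs _ _ hc ha).trans hεr)
  have s3 := abs_le.1 ((hs _ _ hd hb).trans hεr)
  have s4 := abs_le.1 ((hs _ _ hd hc).trans hεr)
  have l1 : a < b := hm.lt_iff_lt.1 (by linarith)
  have l2 : b < c := hm.lt_iff_lt.1 (by linarith)
  have l3 : c < d := hm.lt_iff_lt.1 (by linarith)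
  have hθt : θ * t ≤ t := by nlinarith
  constructor
  · rw [← mul_div_mul_right (2 - θ) (1 + θ) ht.ne']
    exact le_crossRatio_of_scaled hρ (by nlinarith) (by linarith [s2.2]) (by linarith [s3.2]) l1 l3
      (by linarith [s1.1]) (by linarith [s4.1])
  · rw [← mul_div_mul_right (2 + θ) (1 - θ) ht.ne']
    exact crossRatio_le_of_scaled hρ (mul_pos (by linarith) ht) (by positivity)
      (by linarith [s2.1]) (by linarith [s3.1]) (by linarith) (by linarith [s1.2])
      (by linarith [s4.2])

lemma mul_exp_neg_mul_le_of_hit {X L : ℕ → ℝ} {q j : ℕ} {C η κ S : ℝ} (hC : 0 ≤ C) (hη : 0 < η)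
    (hX₀ : 0 ≤ X 0) (hj : j < q) (hL : ∀ k < q, 0 ≤ L k ∧ L k ≤ κ) (hκ : 0 ≤ κ)
    (hS : ∑ k ∈ Finset.range q, L k ≤ S)
    (hX : ∀ k < q, Real.exp (-(C * L k ^ 2)) * X k ≤ X (k + 1))
    (hXj : (1 + η) * Real.exp (-(C * L j ^ 2)) * X j ≤ X (j + 1)) :
    (1 + η) * Real.exp (-(C * (κ * S))) * X 0 ≤ X q := by
  have h1 := exp_neg_sum_mul_le (X := X) (n := q)
    (s := fun k => C * L k ^ 2 - if k = j then Real.log (1 + η) else 0) (by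
      intro k hk
      by_cases hkj : k = j
      · subst hkj
        simp only [if_true]
        rw [neg_sub, sub_eq_add_neg, Real.exp_add, Real.exp_log (by linarith)]
        exact hXj
      · simpa [hkj] using hX k hk)
  refine le_trans (mul_le_mul_of_nonneg_right ?_ hX₀) h1
  rw [Finset.sum_sub_distrib, Finset.sum_ite_eq' , if_pos (Finset.mem_range.2 hj), neg_sub,
    sub_eq_add_neg, Real.exp_add, Real.exp_log (by linarith)]
  gcongr
  rw [← Finset.mul_sum]
  gcongr
  calc _ ≤ ∑ k ∈ Finset.range q, κ * L k := by
        refine Finset.sum_le_sum fun k hk => ?_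
        obtain ⟨h2, h3⟩ := hL k (Finset.mem_range.1 hk)
        rw [pow_two]; gcongr
    _ = κ * ∑ k ∈ Finset.range q, L k := by rw [Finset.mul_sum]
    _ ≤ κ * S := by gcongr

lemma exists_sq_lt {η : ℝ} (hη : 0 < η) : ∃ θ > 0, θ ≤ 1 / 5 ∧
    ((2 + θ) / (1 - θ)) ^ 2 < (1 + η) * ((2 - θ) / (1 + θ)) ^ 2 := by
  have h1 : ContinuousAt (fun θ : ℝ => ((2 + θ) / (1 - θ)) ^ 2) 0 := by
    fun_prop (disch := norm_num)
  have h2 : ContinuousAt (fun θ : ℝ => (1 + η) * ((2 - θ) / (1 + θ)) ^ 2) 0 := by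
    fun_prop (disch := norm_num)
  have h3 : ∀ᶠ θ : ℝ in nhds 0,
      ((2 + θ) / (1 - θ)) ^ 2 < (1 + η) * ((2 - θ) / (1 + θ)) ^ 2 :=
    h1.eventually_lt h2 (by norm_num; linarith)
  have h4 : ∀ᶠ θ : ℝ in nhds 0, θ < 1 / 5 := eventually_lt_nhds (by norm_num)
  obtain ⟨θ, ⟨h5, h6⟩, h7⟩ := (((h3.and h4).filter_mono nhdsWithin_le_nhds).and
    (self_mem_nhdsWithin (s := Ioi (0 : ℝ)))).exists
  exact ⟨θ, h7, h6.le, h5⟩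

namespace MulticriticalCircleMap

variable (f : MulticriticalCircleMap) {H : ℝ → ℝ} {β : ℝ}

/-- The images under `H` of the points mapped to a critical point by an iterate of order less
than `q`. -/
def critHits (H : ℝ → ℝ) (β : ℝ) (q : ℕ) : Set ℝ :=
  {y | ∃ i, ∃ j < q, ∃ l : ℤ, y = H (f.crit i) + l - j * β}

lemma card_critHits_le {p : ℤ} {q : ℕ} (hq : IsDirichletApprox β p q) (hq₁ : 1 < q) {h₀ : ℝ}
    (T : Finset ℝ) (hT : ∀ y ∈ T, y ∈ f.critHits H β q ∧ h₀ ≤ y ∧ y ≤ h₀ + 1 / q) :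
    T.card ≤ 4 * f.N := by
  have : Nonempty (Fin f.N) := ⟨⟨0, f.N_pos⟩⟩
  choose! i j hj l hl using fun y (hy : y ∈ T) => (hT y hy).1
  have hq1' : 1 / (q : ℝ) < 1 := by
    rw [div_lt_one (by exact_mod_cast hq.pos)]; exact_mod_cast hq₁
  have h1 : ∀ e ∈ (Finset.univ : Finset (Fin f.N)), (T.filter fun y => i y = e).card ≤ 4 := by
    intro e _
    have hinj : Set.InjOn j (T.filter fun y => i y = e : Finset ℝ) := by
      intro y hy z hz hyz
      rw [Finset.mem_coe, Finset.mem_filter] at hy hz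
      have hy1 := hl y hy.1
      have hz1 := hl z hz.1
      have hy2 := (hT y hy.1).2
      have hz2 := (hT z hz.1).2
      rw [hy.2] at hy1
      rw [hz.2, ← hyz] at hz1
      have hlt1 : ((l y : ℤ) : ℝ) < l z + 1 := by linarith [hy2.1, hy2.2, hz2.1, hz2.2]
      have hlt2 : ((l z : ℤ) : ℝ) < l y + 1 := by linarith [hy2.1, hy2.2, hz2.1, hz2.2]
      have hlt1' : l y < l z + 1 := by exact_mod_cast hlt1
      have hlt2' : l z < l y + 1 := by exact_mod_cast hlt2
      have : l y = l z := by omega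
      rw [hy1, hz1, this]
    rw [← Finset.card_image_of_injOn hinj]
    have := hq.card_le (u := h₀) (v := h₀ + 1 / q) (t := H (f.crit e)) (m := 1)
      (by push_cast; linarith)
      (s := (T.filter fun y => i y = e).image j)
      (by
        intro k hk
        obtain ⟨y, hy, rfl⟩ := Finset.mem_image.1 hk
        exact hj y (Finset.mem_filter.1 hy).1)
      (by
        intro k hk
        obtain ⟨y, hy, rfl⟩ := Finset.mem_image.1 hk
        obtain ⟨hyT, rfl⟩ := Finset.mem_filter.1 hy
        refine ⟨l y, ?_⟩
        rw [← hl y hyT]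
        exact (hT y hyT).2)
    exact this
  have h2 := Finset.card_le_mul_card_image_of_maps_to (f := i) (s := T) (t := Finset.univ)
    (fun _ _ => Finset.mem_univ _) 4 h1
  simpa using h2

end MulticriticalCircleMap

namespace MulticriticalCircleMap

variable (f : MulticriticalCircleMap) {H : ℝ → ℝ} {β : ℝ}

set_option maxHeartbeats 1600000 in
/-- Herman's argument: the cross-ratio of a quadruple starting at a preimage of a critical point is
expanded by a definite factor, which is impossible where the linearization is almost affine. -/
lemma false_of_almostAffineAt (h : f.IsLinearizedBy H β) (hβ : Irrational β)
    (hE : ∀ ε > 0, ∃ δ > 0, ∀ m : ℕ, ∃ x, AlmostAffineAt H ε δ x ∧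
      AlmostAffineAt H ε δ (f.lift^[m] x)) : False := by
  have hm : StrictMono H := f.strictMono_of_almostAffineAt h hβ fun ε hε => by
    obtain ⟨δ, hδ, hx⟩ := hE ε hε
    obtain ⟨x, hx, -⟩ := hx 0
    exact ⟨δ, hδ, x, hx⟩
  obtain ⟨Λ, hΛ⟩ := f.exists_iterate_crossRatio_ge 1
  obtain ⟨C₁, hC₁, ε₁, hε₁, hloc⟩ := f.exists_local_bounds
  obtain ⟨C₂, hC₂, ε₂, hε₂, hexp⟩ := f.exists_crossRatio_expansion
  obtain ⟨η, hη, hexp⟩ := hexp (8 * Real.exp Λ) (by positivity)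
  set C := C₁ + C₂ with hC
  have hC0 : 0 ≤ C := by positivity
  obtain ⟨θ, hθ, hθ5, hθη⟩ := exists_sq_lt (half_pos hη)
  set κ := min (min ε₁ ε₂) (η / (8 * (C + 1) * (1 + η))) with hκ
  have hκ0 : 0 < κ := lt_min (lt_min hε₁ hε₂) (by positivity)
  have hκη : 1 + η / 2 ≤ (1 + η) * Real.exp (-(C * (κ * 4))) := by
    have h1 : κ * (8 * (C + 1) * (1 + η)) ≤ η := by
      rw [← le_div_iff₀ (by positivity)]; exact min_le_right _ _
    have h2 := Real.add_one_le_exp (-(C * (κ * 4)))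
    have h3 : (1 + η) * (-(C * (κ * 4)) + 1) ≤ (1 + η) * Real.exp (-(C * (κ * 4))) := by gcongr
    nlinarith [mul_pos hκ0 (by linarith : 0 < 1 + η)]
  obtain ⟨σ, hσ, hσκ⟩ := exists_le_sub_of_strictMono hm h.continuous h.add_one hκ0
  have hN : (1 : ℝ) ≤ f.N := by exact_mod_cast f.N_pos
  obtain ⟨δ, hδ, hE⟩ := hE (θ / (192 * f.N)) (by positivity)
  obtain ⟨Q, hQ⟩ := exists_nat_gt (max (max 1 (4 / (δ ^ 2 / 2))) (1 / σ))
  obtain ⟨p, q, hQq, hq⟩ := exists_isDirichletApprox hβ Q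
  have hqQ := hQ.trans_le (by exact_mod_cast hQq : (Q : ℝ) ≤ q)
  have hq0 : (0 : ℝ) < q := by exact_mod_cast hq.pos
  have hq1 : 1 < q := by
    exact_mod_cast ((le_max_left _ _).trans (le_max_left _ _)).trans_lt hqQ
  have hqδ : 4 / (q : ℝ) < δ ^ 2 / 2 := by
    rw [div_lt_comm₀ hq0 (by positivity)]
    exact ((le_max_right _ _).trans (le_max_left _ _)).trans_lt hqQ
  have hqσ : 1 / (q : ℝ) < σ := by
    rw [div_lt_comm₀ hq0 hσ]; exact (le_max_right _ _).trans_lt hqQ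
  have hi : 0 < 1 / (q : ℝ) := by positivity
  have e4 : 4 / (q : ℝ) = 4 * (1 / q) := by ring
  have e2 : 2 / (q : ℝ) = 2 * (1 / q) := by ring
  obtain ⟨x, hx₀, hx⟩ := hE q
  obtain ⟨k, hkq, l, hkl⟩ := hq.exists_abs_sub_le (H (f.crit ⟨0, f.N_pos⟩) - H x)
  rw [abs_le] at hkl
  set t := 1 / (12 * f.N * (q : ℝ)) with ht
  have ht0 : 0 < t := by positivity
  have htq : ((4 * f.N : ℕ) : ℝ) * (3 * t) = 1 / q := by
    rw [ht]; push_cast; field_simp; norm_num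
  have ht1 : 12 * t ≤ 1 / q := by
    rw [← htq]; push_cast; nlinarith
  obtain ⟨y, hyV, hy₁, hy₂, hgap⟩ := exists_gap_of_card_le (V := f.critHits H β q)
    (h₀ := H (f.crit ⟨0, f.N_pos⟩) + l - k * β) (s := 3 * t) (B := 4 * f.N) (by positivity)
    ⟨_, k, hkq, l, rfl⟩ (fun T hT => f.card_critHits_le hq hq1 T (by simpa only [htq] using hT))
  rw [htq] at hy₂
  obtain ⟨i, j, hjq, e, hy⟩ := hyV
  obtain ⟨w, hw⟩ := h.surjective (y - t)
  obtain ⟨x₀, h₀⟩ := h.surjective y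
  obtain ⟨x₁, h₁⟩ := h.surjective (y + t)
  obtain ⟨x₂, h₂⟩ := h.surjective (y + 2 * t)
  obtain ⟨x₃, h₃⟩ := h.surjective (y + 3 * t)
  have l0 : w < x₀ := hm.lt_iff_lt.1 (by linarith)
  have l1 : x₀ < x₁ := hm.lt_iff_lt.1 (by linarith)
  have l2 : x₁ < x₂ := hm.lt_iff_lt.1 (by linarith)
  have l3 : x₂ < x₃ := hm.lt_iff_lt.1 (by linarith)
  have hmono : ∀ n, StrictMono f.lift^[n] := fun n => f.lift_strictMono.iterate n
  have hερ : 4 * (θ / (192 * f.N)) * (4 / q) ≤ θ * t := by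
    refine le_of_eq ?_
    rw [ht]; field_simp; norm_num
  have hε2 : θ / (192 * f.N) ≤ 1 / 2 := by
    rw [div_le_iff₀ (by positivity)]; linarith
  have hiter := fun y => h.map_iterate q y
  have hnear : ∀ z, y - t ≤ H z → H z ≤ y + 3 * t → |H z - H x| ≤ 4 / q := by
    intro z hz₁ hz₂
    rw [abs_le]; constructor <;> linarith
  have hnear' : ∀ z, y - t ≤ H z → H z ≤ y + 3 * t →
      |H (f.lift^[q] z) - H (f.lift^[q] x)| ≤ 4 / q := by
    intro z hz₁ hz₂
    rw [hiter, hiter, add_sub_add_right_eq_sub]; exact hnear z hz₁ hz₂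
  have hX₀ := (hx₀.crossRatio_bounds (a := x₀) (b := x₁) (c := x₂) (d := x₃) hm hδ hε2 hqδ ht0
    hθ.le (by linarith) hερ (hnear _ (by linarith) (by linarith))
    (hnear _ (by linarith) (by linarith)) (by linarith) (by linarith) (by linarith)).1
  have hXq := (hx.crossRatio_bounds (a := f.lift^[q] x₀) (b := f.lift^[q] x₁)
    (c := f.lift^[q] x₂) (d := f.lift^[q] x₃) hm hδ hε2 hqδ ht0
    hθ.le (by linarith) hερ (hnear' _ (by linarith) (by linarith))
    (hnear' _ (by linarith) (by linarith)) (by rw [hiter, hiter]; linarith)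
    (by rw [hiter, hiter]; linarith) (by rw [hiter, hiter]; linarith)).2
  have hYq := (hx.crossRatio_bounds (a := f.lift^[q] w) (b := f.lift^[q] x₀)
    (c := f.lift^[q] x₁) (d := f.lift^[q] x₂) hm hδ hε2 hqδ ht0
    hθ.le (by linarith) hερ (hnear' _ (by linarith) (by linarith))
    (hnear' _ (by linarith) (by linarith)) (by rw [hiter, hiter]; linarith)
    (by rw [hiter, hiter]; linarith) (by rw [hiter, hiter]; linarith)).2
  have hbal : f.lift^[j] x₁ - f.lift^[j] x₀ ≤
      8 * Real.exp Λ * (f.lift^[j] x₂ - f.lift^[j] x₁) := by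
    refine sub_le_mul_of_crossRatio_le (hmono j l0) (hmono j l1) (hmono j l2) ?_
    have h5 := hΛ h hq hq1 (hmono j l0) (hmono j l1) (hmono j l2)
      (by rw [h.map_iterate, h.map_iterate]; push_cast; linarith) (q - j) (Nat.sub_le _ _)
    simp only [← Function.iterate_add_apply, Nat.sub_add_cancel hjq.le] at h5
    have h6 : ((2 + θ) / (1 - θ)) ^ 2 ≤ 8 := by
      have h7 : (2 + θ) / (1 - θ) ≤ 11 / 4 := by
        rw [div_le_div_iff₀ (by linarith) (by norm_num)]; linarith
      have h8 : 0 ≤ (2 + θ) / (1 - θ) := div_nonneg (by linarith) (by linarith)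
      nlinarith
    have h7 := mul_le_mul_of_nonneg_left (h5.trans (hYq.trans h6)) (Real.exp_pos Λ).le
    rw [← mul_assoc, ← Real.exp_add, add_neg_cancel, Real.exp_zero, one_mul] at h7
    linarith
  have hx₀j : f.lift^[j] x₀ ∈ f.critLift := by
    refine ⟨i, e, hm.injective ?_⟩
    rw [h.map_iterate, add_int_of_add_one h.add_one, h₀, hy]; ring
  have hlen : ∀ n, f.lift^[n] x₃ - f.lift^[n] x₀ < κ := by
    intro n
    by_contra hcon
    have h5 := hσκ (f.lift^[n] x₀)
    have h6 := hm.monotone (by linarith : f.lift^[n] x₀ + κ ≤ f.lift^[n] x₃)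
    rw [h.map_iterate] at h5 h6
    linarith
  have hnocrit : ∀ n < q, ∀ z ∈ f.critLift, ¬ (f.lift^[n] x₀ < z ∧ z < f.lift^[n] x₃) := by
    rintro n hn z ⟨i', e', rfl⟩ ⟨hz₁, hz₂⟩
    have h5 := hm hz₁
    have h6 := hm hz₂
    rw [h.map_iterate, add_int_of_add_one h.add_one] at h5 h6
    exact hgap _ ⟨i', n, hn, e', rfl⟩ ⟨by linarith, by linarith⟩
  have hX0 : 0 < crossRatio x₀ x₁ x₂ x₃ := crossRatio_pos l1 l2 l3
  have hXn : ∀ n, 0 < crossRatio (f.lift^[n] x₀) (f.lift^[n] x₁) (f.lift^[n] x₂) (f.lift^[n] x₃) :=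
    fun n => crossRatio_pos (hmono n l1) (hmono n l2) (hmono n l3)
  have l03 : x₀ < x₃ := l1.trans (l2.trans l3)
  have hsum := h.sum_sub_le (a := x₀) (b := x₃) hq hq1 l03.le (by push_cast; linarith)
  have hκε₁ : κ ≤ ε₁ := (min_le_left _ _).trans (min_le_left _ _)
  have hκε₂ : κ ≤ ε₂ := (min_le_left _ _).trans (min_le_right _ _)
  have hmain := mul_exp_neg_mul_le_of_hit (q := q) (j := j) (C := C) (η := η) (κ := κ) (S := 4)
    (X := fun n => crossRatio (f.lift^[n] x₀) (f.lift^[n] x₁) (f.lift^[n] x₂) (f.lift^[n] x₃))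
    (L := fun n => f.lift^[n] x₃ - f.lift^[n] x₀) hC0 hη hX0.le hjq
    (fun n _ => ⟨sub_nonneg.2 (hmono n l03).le, (hlen n).le⟩) hκ0.le
    (hsum.trans (by norm_num))
    (fun n hn => by
      simp only [Function.iterate_succ_apply']
      refine le_trans ?_ ((hloc _ _ (hmono n l03).le ((hlen n).trans_le hκε₁)).2 _ _
        (hmono n l1) (hmono n l2) (hmono n l3) (hnocrit n hn))
      refine mul_le_mul_of_nonneg_right ?_ (hXn n).le
      gcongr
      linarith)
    (by
      simp only [Function.iterate_succ_apply']
      refine le_trans ?_ (hexp _ hx₀j _ _ _ (hmono j l1) (hmono j l2) (hmono j l3)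
        (by linarith [hlen j]) hbal)
      refine mul_le_mul_of_nonneg_right ?_ (hXn j).le
      gcongr
      linarith)
  have h5 := mul_le_mul_of_nonneg_right hκη hX0.le
  have h6 : (1 + η / 2) * ((2 - θ) / (1 + θ)) ^ 2 ≤ (1 + η / 2) * crossRatio x₀ x₁ x₂ x₃ := by
    gcongr
  simp only [Function.iterate_zero_apply] at hmain
  linarith

end MulticriticalCircleMap

/-- If the rotation number of a `C³` multicritical circle map is irrational and not of
bounded type (`ρ(f) ∉ D_0`), then its unique invariant measure is singular with respect
to Lebesgue measure. -/
theorem stmt2 (f : MulticriticalCircleMap) (α : ℝ) (hirr : Irrational α)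
    (hrot : HasRotationNumber f.toCircleHomeo α) (μ : Measure Circle1)
    (hμ : IsInvProbMeasure f.toCircleHomeo μ)
    (huniq : ∀ ν : Measure Circle1, IsInvProbMeasure f.toCircleHomeo ν → ν = μ)
    (hD : α ∉ DiophTau 0) :
    ∃ X : Set Circle1, MeasurableSet X ∧ volume X = 0 ∧ μ X = 1 := by
  by_contra hs
  have hac := f.absolutelyContinuous_of_not_singular hμ huniq hs
  obtain ⟨hprob, hinv⟩ := hμ
  obtain ⟨-, β, hβα, hβ⟩ := hrot
  have hβirr : Irrational β := by
    rw [← Int.floor_add_fract β, hβα]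
    exact hirr.intCast_add _
  obtain ⟨H, hc, hm, h1, hH, hd⟩ := exists_distribution hac
  exact f.false_of_almostAffineAt
    ⟨hc, hm, h1, f.toCircleHomeo.distribution_lift_eq hinv hm h1 hH hβ⟩ hβirr
    fun _ hε => f.toCircleHomeo.exists_almostAffineAt hinv hac hc h1 hd hε
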